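/- Let A be a commutative Noetherian ring of Krull dimension zero and let R = A[x_1,...,x_n] be a polynomial ring over A. Then for every ideal I of R and every integer i ≥ 0, the set of associated primes Ass_R H^i_I(R) is finite. -/

import Mathlib

/-!
STATEMENT 0: Let `A` be a commutative Noetherian ring of Krull dimension zero and let
`R = A[x_1,...,x_n]` be a polynomial ring over `A`.  Then for every ideal `I` of `R` and
every `i ≥ 0`, the set of associated primes `Ass_R H^i_I(R)` is finite.
-/

universe u

open CategoryTheory

section part1

set_option linter.unusedSimpArgs false
set_option linter.unusedSectionVars false

namespace LCFin

open Finset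

/-- Formal power series in `n` variables with coefficients in a module. -/
def PS (n : ℕ) (M : Type*) := (Fin n →₀ ℕ) → M

section PS

variable {n : ℕ} {M : Type*} [AddCommGroup M]

instance : AddCommGroup (PS n M) := inferInstanceAs (AddCommGroup ((Fin n →₀ ℕ) → M))

theorem PS.add_apply (v w : PS n M) (a) : (v + w) a = v a + w a := rfl
theorem PS.zero_apply (a) : (0 : PS n M) a = 0 := rfl

variable {B : Type*} [CommRing B] [Module B M]

noncomputable instance : SMul (MvPowerSeries (Fin n) B) (PS n M) where
  smul p v := fun a => ∑ x ∈ HasAntidiagonal.antidiagonal a, MvPowerSeries.coeff x.1 p • v x.2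

theorem PS.smul_apply (p : MvPowerSeries (Fin n) B) (v : PS n M) (a) :
    (p • v) a = ∑ x ∈ HasAntidiagonal.antidiagonal a, MvPowerSeries.coeff x.1 p • v x.2 := rfl

noncomputable instance : Module (MvPowerSeries (Fin n) B) (PS n M) where
  one_smul v := by
    funext a
    rw [PS.smul_apply]
    rw [Finset.sum_eq_single (0, a)]
    · simp
    · rintro ⟨b, c⟩ h1 h2
      have : b ≠ 0 := by
        rintro rfl
        apply h2
        simp only [HasAntidiagonal.mem_antidiagonal, zero_add] at h1
        rw [h1]
      simp [MvPowerSeries.coeff_one, this]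
    · intro h
      simp at h
  mul_smul p q v := by
    funext a
    simp only [PS.smul_apply, MvPowerSeries.coeff_mul, Finset.sum_smul, Finset.smul_sum,
      Finset.sum_sigma']
    apply Finset.sum_nbij' (fun ⟨⟨_i, j⟩, ⟨k, l⟩⟩ ↦ ⟨(k, l + j), (l, j)⟩)
      (fun ⟨⟨i, _j⟩, ⟨k, l⟩⟩ ↦ ⟨(i + k, l), (i, k)⟩)
    · rintro ⟨⟨i, j⟩, ⟨k, l⟩⟩ h
      simp only [mem_sigma, HasAntidiagonal.mem_antidiagonal] at h ⊢
      exact ⟨by rw [← h.1, ← h.2, add_assoc], trivial⟩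
    · rintro ⟨⟨i, j⟩, ⟨k, l⟩⟩ h
      simp only [mem_sigma, HasAntidiagonal.mem_antidiagonal] at h ⊢
      exact ⟨by rw [← h.1, ← h.2, add_assoc], trivial⟩
    · rintro ⟨⟨i, j⟩, ⟨k, l⟩⟩ h
      simp only [mem_sigma, HasAntidiagonal.mem_antidiagonal] at h ⊢
      obtain ⟨rfl, rfl⟩ := h
      rfl
    · rintro ⟨⟨i, j⟩, ⟨k, l⟩⟩ h
      simp only [mem_sigma, HasAntidiagonal.mem_antidiagonal] at h ⊢
      obtain ⟨rfl, rfl⟩ := h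
      rfl
    · rintro ⟨⟨i, j⟩, ⟨k, l⟩⟩ h
      simp [mul_smul]
  smul_zero p := by
    funext a
    simp [PS.smul_apply, PS.zero_apply]
  smul_add p v w := by
    funext a
    simp [PS.smul_apply, PS.add_apply, Finset.sum_add_distrib]
  add_smul p q v := by
    funext a
    simp [PS.smul_apply, PS.add_apply, Finset.sum_add_distrib, add_smul]
  zero_smul v := by
    funext a
    simp [PS.smul_apply, PS.zero_apply]

end PS

variable {A : Type u} [CommRing A] {n : ℕ}

/-- The Taylor homomorphism `f(x) ↦ f(x+t)`. -/
noncomputable def taylor (n : ℕ) (A : Type u) [CommRing A] :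
    MvPolynomial (Fin n) A →ₐ[A] MvPowerSeries (Fin n) (MvPolynomial (Fin n) A) :=
  MvPolynomial.aeval (fun j => MvPowerSeries.C (MvPolynomial.X j) + MvPowerSeries.X j)

/-- Hasse derivatives of polynomials. -/
noncomputable def hs (b : Fin n →₀ ℕ) (r : MvPolynomial (Fin n) A) : MvPolynomial (Fin n) A :=
  MvPowerSeries.coeff b (taylor n A r)

theorem hs_add (b : Fin n →₀ ℕ) (r s : MvPolynomial (Fin n) A) : hs b (r + s) = hs b r + hs b s := by
  simp [hs]

theorem hs_mul (b : Fin n →₀ ℕ) (r s : MvPolynomial (Fin n) A) :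
    hs b (r * s) = ∑ x ∈ HasAntidiagonal.antidiagonal b, hs x.1 r * hs x.2 s := by
  simp [hs, MvPowerSeries.coeff_mul]

theorem hs_C (b : Fin n →₀ ℕ) (a : A) :
    hs b (MvPolynomial.C a) = if b = 0 then MvPolynomial.C a else 0 := by
  classical
  have : taylor n A (MvPolynomial.C a) = MvPowerSeries.C (MvPolynomial.C a) := by
    rw [taylor, MvPolynomial.aeval_C, MvPowerSeries.algebraMap_apply, MvPolynomial.algebraMap_eq]
  rw [hs, this, MvPowerSeries.coeff_C]

theorem hs_X (b : Fin n →₀ ℕ) (j : Fin n) :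
    hs b (MvPolynomial.X j : MvPolynomial (Fin n) A) =
      (if b = 0 then MvPolynomial.X j else 0) + (if b = Finsupp.single j 1 then 1 else 0) := by
  classical
  rw [hs, taylor, MvPolynomial.aeval_X, map_add, MvPowerSeries.coeff_C, MvPowerSeries.coeff_X]

theorem hs_zero (r : MvPolynomial (Fin n) A) : hs 0 r = r := by
  induction r using MvPolynomial.induction_on with
  | C a => simp [hs_C]
  | add p q hp hq => rw [hs_add, hp, hq]
  | mul_X p j hp =>
    have : (0 : Fin n →₀ ℕ) ≠ Finsupp.single j 1 := by
      intro h
      have := congrArg (fun f => f j) h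
      simp at this
    rw [hs_mul]
    simp [hp, hs_X, this]

theorem constantCoeff_hs (b : Fin n →₀ ℕ) (r : MvPolynomial (Fin n) A) :
    MvPolynomial.constantCoeff (hs b r) = MvPolynomial.coeff b r := by
  have h : ((MvPowerSeries.map (σ := Fin n) (MvPolynomial.constantCoeff (R := A) (σ := Fin n))).comp
      (taylor n A).toRingHom) = MvPolynomial.coeToMvPowerSeries.ringHom := by
    apply MvPolynomial.ringHom_ext
    · intro a
      have : taylor n A (MvPolynomial.C a) = MvPowerSeries.C (MvPolynomial.C a) := by
        rw [taylor, MvPolynomial.aeval_C, MvPowerSeries.algebraMap_apply,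
          MvPolynomial.algebraMap_eq]
      simp [this]
    · intro i
      simp [taylor]
  have h2 := congrArg (fun φ => MvPowerSeries.coeff b (φ r)) h
  simpa [hs] using h2

/-- Hasse derivatives lower the degree. -/
theorem hs_support (r : MvPolynomial (Fin n) A) (d : ℕ) (hr : r.totalDegree ≤ d) (b s : Fin n →₀ ℕ)
    (hs' : s ∈ (hs b r).support) : s.degree + b.degree ≤ d := by
  classical
  -- monomials
  have mono : ∀ (a : Fin n →₀ ℕ) (c : A) (b s : Fin n →₀ ℕ),
      s ∈ (hs b (MvPolynomial.monomial a c)).support → s.degree + b.degree ≤ a.degree := by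
    intro a
    induction a using Finsupp.induction_linear with
    | zero =>
      intro c b s h
      rw [← MvPolynomial.C_apply, hs_C] at h
      split_ifs at h with hb
      · subst hb
        rw [MvPolynomial.mem_support_iff, MvPolynomial.coeff_C] at h
        have : s = 0 := by
          by_contra h2
          exact h (if_neg (fun h3 => h2 h3.symm))
        simp [this]
      · simp at h
    | add a1 a2 h1 h2 =>
      intro c b s h
      have e : MvPolynomial.monomial (a1 + a2) c =
        MvPolynomial.monomial a1 c * MvPolynomial.monomial a2 1 := by
        rw [MvPolynomial.monomial_mul, mul_one]
      rw [e, hs_mul] at h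
      have h3 := MvPolynomial.support_sum h
      rw [Finset.mem_biUnion] at h3
      obtain ⟨x, hx, h4⟩ := h3
      have h5 := MvPolynomial.support_mul _ _ h4
      rw [Finset.mem_add] at h5
      obtain ⟨s1, hs1, s2, hs2, rfl⟩ := h5
      have := h1 c _ _ hs1
      have := h2 1 _ _ hs2
      rw [HasAntidiagonal.mem_antidiagonal] at hx
      rw [← hx]
      simp only [map_add] at *
      omega
    | single j m =>
      induction m with
      | zero =>
        intro c b s h
        rw [Finsupp.single_zero, ← MvPolynomial.C_apply, hs_C] at h
        split_ifs at h with hb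
        · subst hb
          rw [MvPolynomial.mem_support_iff, MvPolynomial.coeff_C] at h
          have : s = 0 := by
            by_contra h2
            exact h (if_neg (fun h3 => h2 h3.symm))
          simp [this]
        · simp at h
      | succ m ih =>
        intro c b s h
        have e : MvPolynomial.monomial (Finsupp.single j (m + 1)) c =
          MvPolynomial.monomial (Finsupp.single j m) c * MvPolynomial.X j := by
          rw [MvPolynomial.X, MvPolynomial.monomial_mul, mul_one, Finsupp.single_add]
        rw [e, hs_mul] at h
        have h3 := MvPolynomial.support_sum h
        rw [Finset.mem_biUnion] at h3
        obtain ⟨x, hx, h4⟩ := h3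
        have h5 := MvPolynomial.support_mul _ _ h4
        rw [Finset.mem_add] at h5
        obtain ⟨s1, hs1, s2, hs2, rfl⟩ := h5
        have h6 := ih c _ _ hs1
        have h7 : s2.degree + x.2.degree ≤ 1 := by
          rw [hs_X] at hs2
          have h8 := MvPolynomial.support_add hs2
          rw [Finset.mem_union] at h8
          rcases h8 with h8 | h8
          · split_ifs at h8 with h9
            · have h10 : s2 ∈ ({Finsupp.single j 1} : Finset _) :=
                MvPolynomial.support_monomial_subset h8
              rw [Finset.mem_singleton] at h10
              simp [h10, h9]
            · simp at h8
          · split_ifs at h8 with h9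
            · have h10 : s2 ∈ ({0} : Finset _) := by
                rw [← MvPolynomial.C_1] at h8
                exact MvPolynomial.support_monomial_subset h8
              rw [Finset.mem_singleton] at h10
              simp [h10, h9]
            · simp at h8
        rw [HasAntidiagonal.mem_antidiagonal] at hx
        rw [← hx]
        simp only [map_add, Finsupp.degree_single] at *
        omega
  have hsum : hs b r = ∑ a ∈ r.support, hs b (MvPolynomial.monomial a (r.coeff a)) := by
    conv_lhs => rw [MvPolynomial.as_sum r]
    simp only [hs, map_sum]
  rw [hsum] at hs'
  have h3 := MvPolynomial.support_sum hs'
  rw [Finset.mem_biUnion] at h3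
  obtain ⟨a, ha, h4⟩ := h3
  have h5 := mono a _ _ _ h4
  have h6 := MvPolynomial.le_totalDegree ha
  have h7 : a.degree = (a.sum fun _ e => e) := rfl
  omega

theorem hs_totalDegree (r : MvPolynomial (Fin n) A) (b : Fin n →₀ ℕ) :
    (hs b r).totalDegree ≤ r.totalDegree := by
  rw [MvPolynomial.totalDegree, Finset.sup_le_iff]
  intro s h
  have := hs_support r _ le_rfl b s h
  have h7 : s.degree = (s.sum fun _ e => e) := rfl
  omega

theorem hs_top (r : MvPolynomial (Fin n) A) (b : Fin n →₀ ℕ) (h : r.totalDegree ≤ b.degree) :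
    hs b r = MvPolynomial.C (r.coeff b) := by
  rw [← constantCoeff_hs]
  have : (hs b r).totalDegree = 0 := by
    rw [← Nat.le_zero, MvPolynomial.totalDegree, Finset.sup_le_iff]
    intro s h'
    have := hs_support r _ h b s h'
    have h7 : s.degree = (s.sum fun _ e => e) := rfl
    omega
  rw [MvPolynomial.totalDegree_eq_zero_iff_eq_C] at this
  exact this

end LCFin

end part1

section part2

set_option linter.unusedSimpArgs false
set_option linter.unusedSectionVars false

namespace LCFin

open Finset

variable {A : Type u} [CommRing A] {n : ℕ}

/-- A (weak) `D`-module structure: an action of the Hasse derivatives satisfying the Leibniz rule. -/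
class DStr (n : ℕ) (A : Type u) [CommRing A] (M : Type*) [AddCommGroup M]
    [Module (MvPolynomial (Fin n) A) M] where
  tau : M →+ PS n M
  tau_zero : ∀ m, tau m 0 = m
  tau_smul : ∀ (r : MvPolynomial (Fin n) A) (m : M), tau (r • m) = taylor n A r • tau m

section basic

variable {M : Type*} [AddCommGroup M] [Module (MvPolynomial (Fin n) A) M] [DStr n A M]

/-- The Hasse derivative acting on a module. -/
def dd (n : ℕ) (A : Type u) [CommRing A] {M : Type*} [AddCommGroup M]
    [Module (MvPolynomial (Fin n) A) M] [DStr n A M] (b : Fin n →₀ ℕ) (m : M) : M :=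
  DStr.tau (n := n) (A := A) m b

theorem dd_add (b : Fin n →₀ ℕ) (m m' : M) : dd n A b (m + m') = dd n A b m + dd n A b m' := by
  simp only [dd, map_add, PS.add_apply]

theorem dd_map_zero (b : Fin n →₀ ℕ) : dd n A b (0 : M) = 0 := by
  simp only [dd, map_zero, PS.zero_apply]

theorem dd_zero (m : M) : dd n A 0 m = m := DStr.tau_zero m

theorem dd_smul (b : Fin n →₀ ℕ) (r : MvPolynomial (Fin n) A) (m : M) :
    dd n A b (r • m) = ∑ x ∈ HasAntidiagonal.antidiagonal b, hs x.1 r • dd n A x.2 m := by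
  simp only [dd, DStr.tau_smul, PS.smul_apply, hs]

theorem dd_smul_C (b : Fin n →₀ ℕ) (a : A) (m : M) :
    dd n A b ((MvPolynomial.C a : MvPolynomial (Fin n) A) • m) =
      (MvPolynomial.C a : MvPolynomial (Fin n) A) • dd n A b m := by
  rw [dd_smul, Finset.sum_eq_single (0, b)]
  · simp [hs_C]
  · rintro ⟨b', c⟩ h1 h2
    have : b' ≠ 0 := by
      rintro rfl
      apply h2
      simp only [HasAntidiagonal.mem_antidiagonal, zero_add] at h1
      rw [h1]
    simp [hs_C, this]
  · intro h
    simp at h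

/-- the Leibniz rule with the leading term separated. -/
theorem smul_dd (b : Fin n →₀ ℕ) (r : MvPolynomial (Fin n) A) (m : M) :
    r • dd n A b m = dd n A b (r • m) -
      ∑ x ∈ (HasAntidiagonal.antidiagonal b).erase (0, b), hs x.1 r • dd n A x.2 m := by
  rw [dd_smul, ← Finset.add_sum_erase _ _ (a := (0, b))]
  · simp [hs_zero]
  · simp

theorem mem_erase_antidiagonal {b : Fin n →₀ ℕ} {x : (Fin n →₀ ℕ) × (Fin n →₀ ℕ)}
    (hx : x ∈ (HasAntidiagonal.antidiagonal b).erase (0, b)) :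
    x.1.degree + x.2.degree = b.degree ∧ 0 < x.1.degree := by
  obtain ⟨b', c⟩ := x
  rw [Finset.mem_erase, HasAntidiagonal.mem_antidiagonal] at hx
  obtain ⟨h1, h2⟩ := hx
  simp only at h2
  refine ⟨by rw [← h2, map_add], ?_⟩
  apply Nat.pos_of_ne_zero
  intro h
  apply h1
  rw [Finsupp.degree_eq_zero_iff] at h
  simp only at h
  subst h
  rw [zero_add] at h2
  rw [h2]

theorem dd_smul_X (b : Fin n →₀ ℕ) (j : Fin n) (m : M) :
    dd n A b ((MvPolynomial.X j : MvPolynomial (Fin n) A) • m) =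
      (MvPolynomial.X j : MvPolynomial (Fin n) A) • dd n A b m +
      if 0 < b j then dd n A (b - Finsupp.single j 1) m else 0 := by
  classical
  rw [dd_smul]
  simp only [hs_X, add_smul, Finset.sum_add_distrib]
  congr 1
  · rw [Finset.sum_eq_single (0, b)]
    · simp
    · rintro ⟨b', c⟩ h1 h2
      have : b' ≠ 0 := by
        rintro rfl
        apply h2
        simp only [HasAntidiagonal.mem_antidiagonal, zero_add] at h1
        rw [h1]
      simp [this]
    · intro h
      simp at h
  · split_ifs with hb
    · have hle : Finsupp.single j 1 ≤ b := by
        rw [Finsupp.single_le_iff]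
        exact hb
      rw [Finset.sum_eq_single (Finsupp.single j 1, b - Finsupp.single j 1)]
      · simp
      · rintro ⟨b', c⟩ h1 h2
        have : b' ≠ Finsupp.single j 1 := by
          rintro rfl
          apply h2
          simp only [HasAntidiagonal.mem_antidiagonal] at h1
          rw [← h1]
          simp
        simp [this]
      · intro h
        exfalso
        apply h
        rw [HasAntidiagonal.mem_antidiagonal]
        exact add_tsub_cancel_of_le hle
    · apply Finset.sum_eq_zero
      rintro ⟨b', c⟩ h1
      have : b' ≠ Finsupp.single j 1 := by
        rintro rfl
        apply hb
        simp only [HasAntidiagonal.mem_antidiagonal] at h1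
        rw [← h1]
        simp
      simp [this]

end basic

noncomputable instance : DStr n A (MvPolynomial (Fin n) A) where
  tau :=
    { toFun := fun r b => hs b r
      map_zero' := by
        funext b
        simp [hs, PS.zero_apply]
      map_add' := fun r s => by
        funext b
        change hs b (r + s) = hs b r + hs b s
        exact hs_add b r s }
  tau_zero m := hs_zero m
  tau_smul r m := by
    funext b
    change hs b (r * m) = ∑ x ∈ HasAntidiagonal.antidiagonal b, hs x.1 r * hs x.2 m
    exact hs_mul b r m

theorem dd_self (b : Fin n →₀ ℕ) (r : MvPolynomial (Fin n) A) : dd n A b r = hs b r := rfl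

noncomputable instance : DStr n A PUnit.{u+1} where
  tau := 0
  tau_zero m := rfl
  tau_smul r m := by
    funext b
    rfl

noncomputable instance {M N : Type u} [AddCommGroup M] [Module (MvPolynomial (Fin n) A) M]
    [DStr n A M] [AddCommGroup N] [Module (MvPolynomial (Fin n) A) N] [DStr n A N] :
    DStr n A (M × N) where
  tau :=
    { toFun := fun p b => (dd n A b p.1, dd n A b p.2)
      map_zero' := by
        funext b
        simp [dd_map_zero, PS.zero_apply]
      map_add' := fun r s => by
        funext b
        change (dd n A b (r.1 + s.1), dd n A b (r.2 + s.2)) =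
          (dd n A b r.1 + dd n A b s.1, dd n A b r.2 + dd n A b s.2)
        rw [dd_add, dd_add] }
  tau_zero m := by
    change (dd n A 0 m.1, dd n A 0 m.2) = m
    rw [dd_zero, dd_zero]
  tau_smul r m := by
    funext b
    change (dd n A b (r • m.1), dd n A b (r • m.2)) =
      ∑ x ∈ HasAntidiagonal.antidiagonal b, hs x.1 r • (dd n A x.2 m.1, dd n A x.2 m.2)
    rw [dd_smul, dd_smul]
    ext
    · simp [Prod.fst_sum]
    · simp [Prod.snd_sum]

theorem dd_prod {M N : Type u} [AddCommGroup M] [Module (MvPolynomial (Fin n) A) M]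
    [DStr n A M] [AddCommGroup N] [Module (MvPolynomial (Fin n) A) N] [DStr n A N]
    (b : Fin n →₀ ℕ) (p : M × N) : dd n A b p = (dd n A b p.1, dd n A b p.2) := rfl

section loc

variable {M : Type u} [AddCommGroup M] [Module (MvPolynomial (Fin n) A) M] [DStr n A M]
variable (f : MvPolynomial (Fin n) A)

/-- The Taylor map to power series over the localization. -/
noncomputable def taylorLoc : MvPolynomial (Fin n) A →+*
    MvPowerSeries (Fin n) (Localization (Submonoid.powers f)) :=
  (MvPowerSeries.map (algebraMap _ _)).comp (taylor n A).toRingHom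

theorem taylorLoc_smul (r : MvPolynomial (Fin n) A)
    (v : PS n (LocalizedModule (Submonoid.powers f) M)) :
    taylorLoc f r • v = taylor n A r • v := by
  funext b
  simp [PS.smul_apply, taylorLoc, algebraMap_smul]

theorem isUnit_taylorLoc : IsUnit (taylorLoc f f) := by
  rw [MvPowerSeries.isUnit_iff_constantCoeff]
  have : MvPowerSeries.constantCoeff (taylorLoc f f) = algebraMap _ _ f := by
    have h := hs_zero f
    rw [hs, MvPowerSeries.coeff_zero_eq_constantCoeff] at h
    simp [taylorLoc, h]
  rw [this]
  exact IsLocalization.map_units _ (⟨f, Submonoid.mem_powers f⟩ : Submonoid.powers f)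

/-- power series over the localized module, with the module structure via Taylor expansion. -/
def JL (M : Type u) [AddCommGroup M] [Module (MvPolynomial (Fin n) A) M]
    (f : MvPolynomial (Fin n) A) := PS n (LocalizedModule (Submonoid.powers f) M)

noncomputable instance : AddCommGroup (JL M f) :=
  inferInstanceAs (AddCommGroup (PS n (LocalizedModule (Submonoid.powers f) M)))

noncomputable instance : Module (MvPowerSeries (Fin n) (Localization (Submonoid.powers f)))
    (JL M f) :=
  inferInstanceAs (Module (MvPowerSeries (Fin n) (Localization (Submonoid.powers f)))
    (PS n (LocalizedModule (Submonoid.powers f) M)))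

noncomputable instance : Module (MvPolynomial (Fin n) A) (JL M f) :=
  Module.compHom _ (taylorLoc f)

theorem JL_smul (r : MvPolynomial (Fin n) A) (v : JL M f) : r • v = taylorLoc f r • v := rfl

theorem JL_smul_apply (r : MvPolynomial (Fin n) A) (v : JL M f) (b : Fin n →₀ ℕ) :
    (r • v) b = ∑ x ∈ HasAntidiagonal.antidiagonal b, hs x.1 r • v x.2 :=
  congrFun (taylorLoc_smul f r v) b

/-- The map of `M` to the twisted module. -/
noncomputable def toJL : M →ₗ[MvPolynomial (Fin n) A] JL M f where
  toFun m := fun b => LocalizedModule.mkLinearMap (Submonoid.powers f) M (dd n A b m)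
  map_add' m m' := by
    funext b
    rw [dd_add, map_add]
    rfl
  map_smul' r m := by
    funext b
    refine Eq.trans ?_ (JL_smul_apply f r _ b).symm
    simp only [dd_smul, map_sum, map_smul]

theorem isUnit_JL (s : Submonoid.powers f) :
    IsUnit (algebraMap (MvPolynomial (Fin n) A) (Module.End (MvPolynomial (Fin n) A) (JL M f)) s) := by
  obtain ⟨s, k, rfl⟩ := s
  have h : IsUnit (taylorLoc f (f ^ k)) := by
    rw [map_pow]
    exact (isUnit_taylorLoc f).pow k
  rw [Module.End.isUnit_iff]
  obtain ⟨w, hw⟩ := h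
  have e : ∀ v : JL M f, (algebraMap (MvPolynomial (Fin n) A) (Module.End (MvPolynomial (Fin n) A) (JL M f)) (f ^ k)) v
      = w • v := by
    intro v
    rw [Module.algebraMap_end_apply, JL_smul, ← hw]
    rfl
  constructor
  · intro v v' h
    simp only [e] at h
    have := congrArg (fun z => w⁻¹ • z) h
    simpa using this
  · intro v
    refine ⟨w⁻¹ • v, ?_⟩
    simp only [e]
    simp

noncomputable instance locDStr : DStr n A (LocalizedModule (Submonoid.powers f) M) where
  tau := (LocalizedModule.lift (Submonoid.powers f) (toJL f) (isUnit_JL f)).toAddMonoidHom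
  tau_zero m := by
    have key : ∀ (r : MvPolynomial (Fin n) A) (v : JL M f), (r • v) 0 = r • v 0 := by
      intro r v
      rw [JL_smul_apply]
      simp [hs_zero]
    let ev : JL M f →ₗ[MvPolynomial (Fin n) A] LocalizedModule (Submonoid.powers f) M :=
      { toFun := fun v => v 0
        map_add' := fun v w => rfl
        map_smul' := key }
    have h : ev.comp (LocalizedModule.lift (Submonoid.powers f) (toJL f) (isUnit_JL f)) =
        LinearMap.id := by
      apply IsLocalizedModule.linearMap_ext (Submonoid.powers f)
        (LocalizedModule.mkLinearMap (Submonoid.powers f) M)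
        (LocalizedModule.mkLinearMap (Submonoid.powers f) M)
      rw [LinearMap.comp_assoc, LocalizedModule.lift_comp]
      ext m
      change LocalizedModule.mkLinearMap (Submonoid.powers f) M (dd n A 0 m) = _
      rw [dd_zero]
      rfl
    exact LinearMap.congr_fun h m
  tau_smul r m := by
    have := (LocalizedModule.lift (Submonoid.powers f) (toJL (M := M) f) (isUnit_JL f)).map_smul r m
    refine Eq.trans this ?_
    exact taylorLoc_smul f r _

theorem dd_mk (b : Fin n →₀ ℕ) (m : M) :
    dd n A b (LocalizedModule.mkLinearMap (Submonoid.powers f) M m) =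
      LocalizedModule.mkLinearMap (Submonoid.powers f) M (dd n A b m) := by
  have := LinearMap.congr_fun (LocalizedModule.lift_comp (Submonoid.powers f) (toJL (M := M) f)
    (isUnit_JL f)) m
  exact congrFun this b

end loc

/-- If a map out of a localization commutes with `dd` on `M`, ... -/
theorem dd_map_loc {M N : Type u} [AddCommGroup M] [Module (MvPolynomial (Fin n) A) M] [DStr n A M]
    [AddCommGroup N] [Module (MvPolynomial (Fin n) A) N] [DStr n A N]
    (f : MvPolynomial (Fin n) A) (g : M →ₗ[MvPolynomial (Fin n) A] N)
    (hg : ∀ b m, g (dd n A b m) = dd n A b (g m)) (b : Fin n →₀ ℕ)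
    (m : LocalizedModule (Submonoid.powers f) M) :
    IsLocalizedModule.map (Submonoid.powers f) (LocalizedModule.mkLinearMap (Submonoid.powers f) M)
      (LocalizedModule.mkLinearMap (Submonoid.powers f) N) g (dd n A b m) =
    dd n A b (IsLocalizedModule.map (Submonoid.powers f)
      (LocalizedModule.mkLinearMap (Submonoid.powers f) M)
      (LocalizedModule.mkLinearMap (Submonoid.powers f) N) g m) := by
  set G := IsLocalizedModule.map (Submonoid.powers f)
    (LocalizedModule.mkLinearMap (Submonoid.powers f) M)
      (LocalizedModule.mkLinearMap (Submonoid.powers f) N) g with hG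
  -- double induction
  have inj : ∀ x y : LocalizedModule (Submonoid.powers f) N, f • x = f • y → x = y := by
    intro x y h
    have := (IsLocalizedModule.smul_inj (LocalizedModule.mkLinearMap (Submonoid.powers f) N)
      (⟨f, Submonoid.mem_powers f⟩ : Submonoid.powers f) x y).1 h
    exact this
  have main : ∀ (k : ℕ) (m : LocalizedModule (Submonoid.powers f) M),
      (∃ m', f ^ k • m = LocalizedModule.mkLinearMap (Submonoid.powers f) M m') →
      ∀ (e : ℕ) (b : Fin n →₀ ℕ), b.degree = e → G (dd n A b m) = dd n A b (G m) := by
    intro k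
    induction k with
    | zero =>
      rintro m ⟨m', hm'⟩ e b -
      rw [pow_zero, one_smul] at hm'
      subst hm'
      rw [dd_mk, hG, IsLocalizedModule.map_apply, IsLocalizedModule.map_apply, dd_mk, hg]
    | succ k ih =>
      rintro m ⟨m', hm'⟩ e
      have ih2 := ih (f • m) ⟨m', by rw [← hm', smul_smul, pow_succ]⟩
      induction e using Nat.strong_induction_on with
      | _ e ihe =>
        intro b hb
        apply inj
        rw [← map_smul, smul_dd, smul_dd, map_sub, ih2 _ b rfl, map_smul, map_sum]
        congr 1
        apply Finset.sum_congr rfl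
        intro x hx
        have := mem_erase_antidiagonal hx
        rw [map_smul, ihe x.2.degree (by omega) x.2 rfl]
  obtain ⟨⟨m', ⟨s, k, rfl⟩⟩, hm⟩ := IsLocalizedModule.surj (Submonoid.powers f)
    (LocalizedModule.mkLinearMap (Submonoid.powers f) M) m
  exact main k m ⟨m', hm⟩ _ b rfl

end LCFin

end part2

section part3

set_option linter.unusedSimpArgs false
set_option linter.unusedSectionVars false

namespace LCFin

open Finset

variable {A : Type u} [CommRing A] {n : ℕ}

/-- A good filtration of polynomial growth. -/
structure Filt (n : ℕ) (A : Type u) [CommRing A] (M : Type u) [AddCommGroup M]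
    [Module (MvPolynomial (Fin n) A) M] [DStr n A M] [Module A M]
    [IsScalarTower A (MvPolynomial (Fin n) A) M] where
  F : ℕ → Submodule A M
  C : ℕ
  mono : Monotone F
  X_mem : ∀ i j m, m ∈ F i → (MvPolynomial.X j : MvPolynomial (Fin n) A) • m ∈ F (i + 1)
  dd_mem : ∀ i b m, m ∈ F i → dd n A b m ∈ F (i + b.degree)
  exh : ∀ m, ∃ i, m ∈ F i
  len : ∀ i, Module.length A (F i) ≤ (C * (i + 1) ^ n : ℕ)

section
variable {M : Type u} [AddCommGroup M]
    [Module (MvPolynomial (Fin n) A) M] [DStr n A M] [Module A M]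
    [IsScalarTower A (MvPolynomial (Fin n) A) M]

theorem C_smul' (a : A) (m : M) : (MvPolynomial.C a : MvPolynomial (Fin n) A) • m = a • m := by
  rw [← MvPolynomial.algebraMap_eq, algebraMap_smul]

theorem dd_smul_A (b : Fin n →₀ ℕ) (a : A) (m : M) : dd n A b (a • m) = a • dd n A b m := by
  rw [← C_smul' (n := n), dd_smul_C, C_smul']

theorem Filt.monomial_mem (G : Filt n A M) (s : Fin n →₀ ℕ) : ∀ (w : ℕ) (m : M), m ∈ G.F w →
    (MvPolynomial.monomial s (1 : A)) • m ∈ G.F (w + s.degree) := by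
  induction s using Finsupp.induction_linear with
  | zero =>
    intro w m hm
    have : (MvPolynomial.monomial (0 : Fin n →₀ ℕ) (1 : A)) = 1 := rfl
    simpa [this] using hm
  | add s t hs ht =>
    intro w m hm
    have : (MvPolynomial.monomial (s + t) (1 : A)) = MvPolynomial.monomial t 1 *
        MvPolynomial.monomial s 1 := by
      rw [MvPolynomial.monomial_mul, mul_one, add_comm]
    rw [this, mul_smul, map_add, ← add_assoc]
    exact ht _ _ (hs _ _ hm)
  | single j k =>
    intro w m hm
    have : (MvPolynomial.monomial (Finsupp.single j k) (1 : A)) = MvPolynomial.X j ^ k := by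
      rw [MvPolynomial.X_pow_eq_monomial]
    rw [this, Finsupp.degree_single]
    clear this
    induction k with
    | zero => simpa using hm
    | succ k ih =>
      rw [pow_succ', mul_smul, ← add_assoc]
      exact G.X_mem _ _ _ ih

theorem Filt.smul_mem (G : Filt n A M) (r : MvPolynomial (Fin n) A) (d : ℕ)
    (hr : r.totalDegree ≤ d) (w : ℕ) (m : M) (hm : m ∈ G.F w) : r • m ∈ G.F (w + d) := by
  rw [r.as_sum, Finset.sum_smul]
  apply Submodule.sum_mem
  intro s hs
  have h1 : (MvPolynomial.monomial s) (MvPolynomial.coeff s r) =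
      MvPolynomial.C (MvPolynomial.coeff s r) * MvPolynomial.monomial s 1 := by
    rw [MvPolynomial.C_mul_monomial, mul_one]
  rw [h1, mul_smul, C_smul']
  apply Submodule.smul_mem
  apply G.mono _ (G.monomial_mem s w m hm)
  have := MvPolynomial.le_totalDegree hs
  have h2 : s.degree = s.sum fun _ e => e := rfl
  omega

theorem Filt.pow_mem (G : Filt n A M) (f : MvPolynomial (Fin n) A) (k w : ℕ) (m : M)
    (hm : m ∈ G.F w) : f ^ k • m ∈ G.F (w + f.totalDegree * k) := by
  apply G.smul_mem _ _ _ _ _ hm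
  rw [mul_comm]
  exact MvPolynomial.totalDegree_pow f k

end

section Loc

variable {M N : Type u} [AddCommGroup M]
    [Module (MvPolynomial (Fin n) A) M] [DStr n A M] [Module A M]
    [IsScalarTower A (MvPolynomial (Fin n) A) M] [AddCommGroup N]
    [Module (MvPolynomial (Fin n) A) N] [DStr n A N] [Module A N]
    [IsScalarTower A (MvPolynomial (Fin n) A) N]
    (f : MvPolynomial (Fin n) A) (φ : M →ₗ[MvPolynomial (Fin n) A] N)
    (hφ : ∀ b m, φ (dd n A b m) = dd n A b (φ m))

theorem Filt.loc_key
    (hφ : ∀ b m, φ (dd n A b m) = dd n A b (φ m))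
    (G : Filt n A M) (i : ℕ) : ∀ (w : ℕ) (x : N),
    f ^ i • x ∈ (G.F w).map (φ.restrictScalars A) →
    ∀ (e : ℕ) (b : Fin n →₀ ℕ), b.degree = e →
      f ^ (i + e) • dd n A b x ∈
        (G.F (w + (f.totalDegree + 1) * e)).map (φ.restrictScalars A) := by
  induction i with
  | zero =>
    rintro w x ⟨m, hm, hx⟩ e b rfl
    rw [pow_zero, one_smul] at hx
    subst hx
    refine ⟨f ^ b.degree • dd n A b m, ?_, ?_⟩
    · have := G.pow_mem f b.degree _ _ (G.dd_mem _ b _ hm)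
      refine G.mono ?_ this
      apply le_of_eq; ring
    · rw [zero_add]
      change φ _ = _
      rw [map_smul, hφ]
      rfl
  | succ i ih =>
    intro w x hx e
    have ih2 := ih w (f • x) (by rw [smul_smul, ← pow_succ]; exact hx)
    induction e using Nat.strong_induction_on with
    | _ e ihe =>
      intro b hb
      have e1 : f ^ (i + 1 + e) • dd n A b x = f ^ (i + e) • (f • dd n A b x) := by
        rw [smul_smul, ← pow_succ]; congr 2; ring
      rw [e1, smul_dd, smul_sub, Finset.smul_sum]
      apply Submodule.sub_mem
      · exact ih2 e b hb
      · apply Submodule.sum_mem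
        intro y hy
        have hy := mem_erase_antidiagonal hy
        obtain ⟨m, hm, hm2⟩ := ihe y.2.degree (by omega) y.2 rfl
        have hm2 : φ m = _ := hm2
        refine ⟨f ^ (y.1.degree - 1) • hs y.1 f • m, ?_, ?_⟩
        · refine G.mono ?_ (G.pow_mem f (y.1.degree - 1) _ _ (G.smul_mem _ _
            (hs_totalDegree f y.1) _ _ hm))
          obtain ⟨t, ht⟩ : ∃ t, y.1.degree = t + 1 := ⟨y.1.degree - 1, by omega⟩
          rw [← hb, ← hy.1, ht]
          simp only [Nat.add_sub_cancel]
          nlinarith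
        · change φ _ = _
          rw [map_smul, map_smul, hm2, smul_smul, smul_smul, smul_smul]
          congr 1
          have : i + e = (y.1.degree - 1) + (i + 1 + y.2.degree) := by omega
          rw [this]
          ring

variable [IsLocalizedModule (Submonoid.powers f) φ]

/-- The filtration on a localization. -/
noncomputable def Filt.loc (G : Filt n A M) : Filt n A N := by
  have inj : ∀ (k : ℕ) (x y : N), f ^ k • x = f ^ k • y → x = y := by
    intro k x y h
    exact (IsLocalizedModule.smul_inj φ
      (⟨f ^ k, ⟨k, rfl⟩⟩ : Submonoid.powers f) x y).1 h
  set d := f.totalDegree with hd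
  refine
    { F := fun i => ((G.F ((d + 1) * i)).map (φ.restrictScalars A)).comap
        ((LinearMap.lsmul (MvPolynomial (Fin n) A) N (f ^ i)).restrictScalars A)
      C := G.C * (d + 1) ^ n
      mono := ?_
      X_mem := ?_
      dd_mem := ?_
      exh := ?_
      len := ?_ }
  · apply monotone_nat_of_le_succ
    rintro i x ⟨m, hm, hx⟩
    have hx : φ m = f ^ i • x := hx
    refine ⟨f • m, ?_, ?_⟩
    · exact G.mono (by nlinarith) (G.smul_mem f d hd.symm.le _ _ hm)
    · change φ (f • m) = f ^ (i + 1) • x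
      rw [map_smul, hx, smul_smul, pow_succ']
  · rintro i j x ⟨m, hm, hx⟩
    have hx : φ m = f ^ i • x := hx
    refine ⟨f • (MvPolynomial.X j : MvPolynomial (Fin n) A) • m, ?_, ?_⟩
    · exact G.mono (by nlinarith) (G.smul_mem f d hd.symm.le _ _ (G.X_mem _ j _ hm))
    · change φ _ = f ^ (i + 1) • (_ • x)
      rw [map_smul, map_smul, hx, smul_smul, smul_smul, smul_smul]
      congr 1
      ring
  · intro i b x hx
    have := G.loc_key f φ hφ i _ x hx _ b rfl
    rw [← mul_add] at this
    exact this
  · intro x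
    obtain ⟨⟨m, ⟨s, k, rfl⟩⟩, hm⟩ := IsLocalizedModule.surj (Submonoid.powers f) φ x
    obtain ⟨w, hw⟩ := G.exh m
    refine ⟨k + w, f ^ w • m, ?_, ?_⟩
    · exact G.mono (by nlinarith) (G.pow_mem f w _ _ hw)
    · change φ _ = f ^ (k + w) • x
      have hm : f ^ k • x = φ m := hm
      rw [map_smul, ← hm, smul_smul, ← pow_add, add_comm]
  · intro i
    have h1 : Module.length A ((G.F ((d + 1) * i)).map (φ.restrictScalars A)) ≤
        Module.length A (G.F ((d + 1) * i)) :=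
      Module.length_le_of_surjective ((φ.restrictScalars A).submoduleMap (G.F ((d + 1) * i)))
        (LinearMap.submoduleMap_surjective _ _)
    refine le_trans (Module.length_le_of_injective
      (((LinearMap.lsmul (MvPolynomial (Fin n) A) N (f ^ i)).restrictScalars A).submoduleComap
        ((G.F ((d + 1) * i)).map (φ.restrictScalars A))) ?_) (h1.trans ((G.len _).trans ?_))
    · rintro ⟨x, hx⟩ ⟨y, hy⟩ h
      have := congrArg Subtype.val h
      apply Subtype.ext
      exact inj i x y this
    · norm_cast
      rw [mul_assoc, ← mul_pow]
      gcongr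
      nlinarith

end Loc

/-- The trivial filtration. -/
noncomputable def Filt.ofSubsingleton {M : Type u} [AddCommGroup M]
    [Module (MvPolynomial (Fin n) A) M] [DStr n A M] [Module A M]
    [IsScalarTower A (MvPolynomial (Fin n) A) M] [Subsingleton M] : Filt n A M where
  F _ := ⊤
  C := 0
  mono _ _ _ := le_rfl
  X_mem _ _ _ _ := trivial
  dd_mem _ _ _ _ := trivial
  exh _ := ⟨0, trivial⟩
  len i := by simp [Module.length_eq_zero]

/-- The product filtration. -/
noncomputable def Filt.prod {M N : Type u} [AddCommGroup M]
    [Module (MvPolynomial (Fin n) A) M] [DStr n A M] [Module A M]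
    [IsScalarTower A (MvPolynomial (Fin n) A) M] [AddCommGroup N]
    [Module (MvPolynomial (Fin n) A) N] [DStr n A N] [Module A N]
    [IsScalarTower A (MvPolynomial (Fin n) A) N] (G : Filt n A M) (H : Filt n A N) :
    Filt n A (M × N) where
  F i := (G.F i).prod (H.F i)
  C := G.C + H.C
  mono _ _ h := Submodule.prod_mono (G.mono h) (H.mono h)
  X_mem i j m hm := ⟨G.X_mem i j _ hm.1, H.X_mem i j _ hm.2⟩
  dd_mem i b m hm := ⟨G.dd_mem i b _ hm.1, H.dd_mem i b _ hm.2⟩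
  exh m := by
    obtain ⟨i, hi⟩ := G.exh m.1
    obtain ⟨j, hj⟩ := H.exh m.2
    exact ⟨i + j, G.mono (by omega) hi, H.mono (by omega) hj⟩
  len i := by
    let ψ : ((G.F i).prod (H.F i)) →ₗ[A] (G.F i) × (H.F i) :=
      LinearMap.prod
        (LinearMap.codRestrict _ ((LinearMap.fst A M N).comp (Submodule.subtype _))
          fun x => x.2.1)
        (LinearMap.codRestrict _ ((LinearMap.snd A M N).comp (Submodule.subtype _))
          fun x => x.2.2)
    have hψ : Function.Injective ψ := by
      rintro ⟨x, hx⟩ ⟨y, hy⟩ h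
      have h1 := congrArg Subtype.val (congrArg Prod.fst h)
      have h2 := congrArg Subtype.val (congrArg Prod.snd h)
      exact Subtype.ext (Prod.ext h1 h2)
    refine (Module.length_le_of_injective ψ hψ).trans ?_
    rw [Module.length_prod, add_mul, Nat.cast_add]
    exact add_le_add (G.len i) (H.len i)

theorem card_degree_le (n i : ℕ) :
    ENat.card {s : Fin n →₀ ℕ | s.degree ≤ i} ≤ ((i + 1) ^ n : ℕ) := by
  let g : {s : Fin n →₀ ℕ | s.degree ≤ i} → (Fin n → Fin (i + 1)) := fun s j =>
    ⟨s.1 j, Nat.lt_succ_of_le ((Finsupp.le_degree j s.1).trans s.2)⟩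
  have hg : Function.Injective g := by
    intro s t h
    apply Subtype.ext
    ext j
    exact congrArg Fin.val (congrFun h j)
  refine (ENat.card_le_card_of_injective hg).trans ?_
  simp [ENat.card_eq_coe_fintype_card]

/-- The filtration by degree of the polynomial ring. -/
noncomputable def Filt.base [IsArtinianRing A] : Filt n A (MvPolynomial (Fin n) A) where
  F i := MvPolynomial.restrictTotalDegree (Fin n) A i
  C := (Module.length A A).toNat
  mono i j h x hx := by
    rw [MvPolynomial.mem_restrictTotalDegree] at hx ⊢
    omega
  X_mem i j m hm := by
    rw [MvPolynomial.mem_restrictTotalDegree] at hm ⊢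
    rw [smul_eq_mul]
    refine (MvPolynomial.totalDegree_mul _ _).trans ?_
    rw [add_comm i]
    refine add_le_add ?_ hm
    rw [MvPolynomial.X]
    refine (MvPolynomial.totalDegree_monomial_le _ _).trans ?_
    simp
  dd_mem i b m hm := by
    rw [MvPolynomial.mem_restrictTotalDegree] at hm ⊢
    rw [dd_self]
    have := hs_totalDegree m b
    omega
  exh m := ⟨m.totalDegree, by rw [MvPolynomial.mem_restrictTotalDegree]⟩
  len i := by
    have hfin : Module.length A A ≠ ⊤ := Module.length_ne_top
    have := (MvPolynomial.basisRestrictSupport A {s : Fin n →₀ ℕ | s.degree ≤ i}).repr.length_eq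
    rw [Module.length_finsupp] at this
    have h2 : Module.length A (MvPolynomial.restrictTotalDegree (Fin n) A i) = _ := this
    rw [h2, mul_comm, Nat.cast_mul, ENat.natCast_toNat hfin]
    gcongr
    exact card_degree_le n i

/-- Polynomial growth. -/
def GrowthR (n : ℕ) (A : Type u) [CommRing A] (M : Type u) [AddCommGroup M]
    [Module (MvPolynomial (Fin n) A) M] [DStr n A M] : Prop :=
  ∀ [Module A M] [IsScalarTower A (MvPolynomial (Fin n) A) M], Nonempty (Filt n A M)

theorem GrowthR.base [IsArtinianRing A] : GrowthR n A (MvPolynomial (Fin n) A) := by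
  intro i1 i2
  have : i1 = (Algebra.toModule : Module A (MvPolynomial (Fin n) A)) := by
    apply Module.ext'
    intro r m
    rw [← C_smul' (n := n)]
    rw [smul_eq_mul, MvPolynomial.C_mul']
  subst this
  exact ⟨Filt.base⟩

theorem GrowthR.ofSubsingleton {M : Type u} [AddCommGroup M]
    [Module (MvPolynomial (Fin n) A) M] [DStr n A M] [Subsingleton M] : GrowthR n A M := by
  intro i1 i2
  exact ⟨Filt.ofSubsingleton⟩

theorem isScalarTower_compHom (M : Type u) [AddCommGroup M]
    [Module (MvPolynomial (Fin n) A) M] :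
    letI := Module.compHom M (algebraMap A (MvPolynomial (Fin n) A))
    IsScalarTower A (MvPolynomial (Fin n) A) M := by
  let _ := Module.compHom M (algebraMap A (MvPolynomial (Fin n) A))
  refine ⟨fun a r m => ?_⟩
  rw [Algebra.smul_def, mul_smul]
  rfl

theorem GrowthR.prod {M N : Type u} [AddCommGroup M]
    [Module (MvPolynomial (Fin n) A) M] [DStr n A M] [AddCommGroup N]
    [Module (MvPolynomial (Fin n) A) N] [DStr n A N] (h1 : GrowthR n A M) (h2 : GrowthR n A N) :
    GrowthR n A (M × N) := by
  intro i1 i2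
  let _ := Module.compHom M (algebraMap A (MvPolynomial (Fin n) A))
  have : IsScalarTower A (MvPolynomial (Fin n) A) M := isScalarTower_compHom M
  let _ := Module.compHom N (algebraMap A (MvPolynomial (Fin n) A))
  have : IsScalarTower A (MvPolynomial (Fin n) A) N := isScalarTower_compHom N
  have : i1 = Prod.instModule := by
    apply Module.ext'
    intro r m
    rw [← C_smul' (n := n)]
    rfl
  subst this
  obtain ⟨G⟩ := @h1 _ _
  obtain ⟨H⟩ := @h2 _ _
  exact ⟨G.prod H⟩

theorem GrowthR.loc {M N : Type u} [AddCommGroup M]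
    [Module (MvPolynomial (Fin n) A) M] [DStr n A M] [AddCommGroup N]
    [Module (MvPolynomial (Fin n) A) N] [DStr n A N]
    (f : MvPolynomial (Fin n) A) (φ : M →ₗ[MvPolynomial (Fin n) A] N)
    (hφ : ∀ b m, φ (dd n A b m) = dd n A b (φ m)) [IsLocalizedModule (Submonoid.powers f) φ]
    (h1 : GrowthR n A M) : GrowthR n A N := by
  intro i1 i2
  let _ := Module.compHom M (algebraMap A (MvPolynomial (Fin n) A))
  have : IsScalarTower A (MvPolynomial (Fin n) A) M := isScalarTower_compHom M
  obtain ⟨G⟩ := @h1 _ _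
  exact ⟨G.loc f φ hφ⟩

end LCFin

end part3

section part4

set_option linter.unusedSimpArgs false
set_option linter.unusedSectionVars false

namespace LCFin

open Finset

variable {A : Type u} [CommRing A] {n : ℕ}

/-- Stability under all Hasse derivatives. -/
def DStable {M : Type u} [AddCommGroup M]
    [Module (MvPolynomial (Fin n) A) M] [DStr n A M]
    (K : Submodule (MvPolynomial (Fin n) A) M) : Prop :=
  ∀ (b : Fin n →₀ ℕ) (m : M), m ∈ K → dd n A b m ∈ K

section Bern

variable {M : Type u} [AddCommGroup M]
    [Module (MvPolynomial (Fin n) A) M] [DStr n A M] [Module A M]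
    [IsScalarTower A (MvPolynomial (Fin n) A) M]
    {K : Submodule (MvPolynomial (Fin n) A) M} (hK : DStable K) {W : ℕ → Submodule A M}
    (hmono : Monotone W)
    (hX : ∀ i j m, m ∈ W i → (MvPolynomial.X j : MvPolynomial (Fin n) A) • m ∈ W (i + 1))
    (hD : ∀ i b m, m ∈ W i → dd n A b m ∈ W (i + b.degree))
    {P : Ideal A} (hP : ∀ a ∈ P, ∀ i, ∀ x ∈ W i, a • x ∈ K)
    {w : ℕ} {m₀ : M} (hm₀ : m₀ ∈ W w) (hm₁ : ∀ a, a • m₀ ∈ K → a ∈ P)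

theorem smul_mem_of_coeff
    (hP : ∀ a ∈ P, ∀ i, ∀ x ∈ W i, a • x ∈ K)
    (g : MvPolynomial (Fin n) A) (hg : ∀ s, g.coeff s ∈ P) (i : ℕ) (x : M)
    (hx : x ∈ W i) : g • x ∈ K := by
  rw [g.as_sum, Finset.sum_smul]
  apply Submodule.sum_mem
  intro s _
  have h1 : (MvPolynomial.monomial s) (MvPolynomial.coeff s g) =
      MvPolynomial.monomial s 1 * MvPolynomial.C (MvPolynomial.coeff s g) := by
    rw [mul_comm, MvPolynomial.C_mul_monomial, mul_one]
  rw [h1, mul_smul, C_smul']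
  exact Submodule.smul_mem _ _ (hP _ (hg s) i x hx)

theorem hs_kill
    (hK : DStable K)
    (hmono : Monotone W)
    (hD : ∀ i b m, m ∈ W i → dd n A b m ∈ W (i + b.degree))
    (g : MvPolynomial (Fin n) A) (v : ℕ) (hg : ∀ x ∈ W v, g • x ∈ K) :
    ∀ (e : ℕ) (b : Fin n →₀ ℕ), b.degree = e → ∀ u, u + e = v →
      ∀ x ∈ W u, hs b g • x ∈ K := by
  intro e
  induction e using Nat.strong_induction_on with
  | _ e ihe =>
    intro b hb u hu x hx
    have h1 : dd n A b (g • x) ∈ K := hK _ _ (hg x (hmono (by omega) hx))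
    rw [dd_smul, ← Finset.add_sum_erase _ _ (a := (b, 0)) (by simp)] at h1
    simp only [dd_zero] at h1
    refine (Submodule.add_mem_iff_left _ ?_).1 h1
    apply Submodule.sum_mem
    rintro ⟨b', c⟩ hx'
    rw [Finset.mem_erase, HasAntidiagonal.mem_antidiagonal] at hx'
    obtain ⟨h2, h3⟩ := hx'
    simp only at h3
    have hc : c.degree ≠ 0 := by
      intro h
      rw [Finsupp.degree_eq_zero_iff] at h
      subst h
      rw [add_zero] at h3
      subst h3
      exact h2 rfl
    have h4 : b'.degree + c.degree = b.degree := by rw [← h3, map_add]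
    exact ihe b'.degree (by omega) b' rfl (u + c.degree) (by omega) _ (hD _ _ _ hx)

theorem coeff_mem_of_kill
    (hK : DStable K)
    (hmono : Monotone W)
    (hD : ∀ i b m, m ∈ W i → dd n A b m ∈ W (i + b.degree))
    (hP : ∀ a ∈ P, ∀ i, ∀ x ∈ W i, a • x ∈ K)
    (hm₀ : m₀ ∈ W w)
    (hm₁ : ∀ a, a • m₀ ∈ K → a ∈ P)
    (g : MvPolynomial (Fin n) A) (e : ℕ) (hge : g.totalDegree ≤ e)
    (hg : ∀ x ∈ W (w + e), g • x ∈ K) (s : Fin n →₀ ℕ) : g.coeff s ∈ P := by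
  classical
  let g1 : MvPolynomial (Fin n) A := ∑ s ∈ g.support with g.coeff s ∉ P,
    MvPolynomial.monomial s (g.coeff s)
  have hc1 : ∀ s, g1.coeff s = if g.coeff s ∉ P then g.coeff s else 0 := by
    intro s
    simp only [g1, MvPolynomial.coeff_sum, MvPolynomial.coeff_monomial]
    rw [Finset.sum_ite_eq']
    by_cases h : g.coeff s ∈ P
    · simp [h]
    · have : g.coeff s ≠ 0 := by
        intro h0
        rw [h0] at h
        exact h P.zero_mem
      simp [h, this]
  by_contra hs0
  have hne : g1 ≠ 0 := by
    intro h
    have := hc1 s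
    rw [h, if_pos hs0, MvPolynomial.coeff_zero] at this
    rw [← this] at hs0
    exact hs0 P.zero_mem
  obtain ⟨t, ht, ht2⟩ := Finset.exists_mem_eq_sup g1.support
    (MvPolynomial.support_nonempty.2 hne) (fun s => s.sum fun _ e => e)
  have htd : g1.totalDegree = t.degree := ht2
  have htP : g.coeff t ∉ P := by
    intro h
    rw [MvPolynomial.mem_support_iff, hc1, if_neg (not_not.2 h)] at ht
    exact ht rfl
  have hte : t.degree ≤ e := by
    refine le_trans ?_ hge
    have : t ∈ g.support := by
      rw [MvPolynomial.mem_support_iff]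
      intro h
      rw [h] at htP
      exact htP P.zero_mem
    exact MvPolynomial.le_totalDegree this
  have hg1 : ∀ x ∈ W (w + e), g1 • x ∈ K := by
    intro x hx
    have h2 : (g - g1) • x ∈ K := by
      apply smul_mem_of_coeff hP _ _ _ x hx
      intro s
      rw [MvPolynomial.coeff_sub, hc1]
      by_cases h : g.coeff s ∈ P
      · rw [if_neg (not_not.2 h), sub_zero]
        exact h
      · rw [if_pos h, sub_self]
        exact P.zero_mem
    have : g1 • x = g • x - (g - g1) • x := by
      rw [sub_smul]; abel
    rw [this]
    exact Submodule.sub_mem _ (hg x hx) h2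
  have h3 := hs_kill hK hmono hD g1 (w + e) hg1 t.degree t rfl (w + e - t.degree) (by omega) m₀
    (hmono (by omega) hm₀)
  rw [hs_top g1 t htd.le, C_smul', hc1, if_pos htP] at h3
  exact htP (hm₁ _ h3)

theorem comm_kill
    (hmono : Monotone W)
    (hX : ∀ i j m, m ∈ W i → (MvPolynomial.X j : MvPolynomial (Fin n) A) • m ∈ W (i + 1))
    {ι : Type} (T : Finset ι) (β : ι → (Fin n →₀ ℕ))
    (g : ι → MvPolynomial (Fin n) A) (v : ℕ)
    (hg : ∀ x ∈ W v, ∑ b ∈ T, g b • dd n A (β b) x ∈ K) (c : Fin n →₀ ℕ) :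
    ∀ u, u + c.degree = v → ∀ x ∈ W u,
      (∑ b ∈ T, if c ≤ β b then g b • dd n A (β b - c) x else 0) ∈ K := by
  have main : ∀ (e : ℕ) (c : Fin n →₀ ℕ), c.degree = e → ∀ u, u + c.degree = v → ∀ x ∈ W u,
      (∑ b ∈ T, if c ≤ β b then g b • dd n A (β b - c) x else 0) ∈ K := by
    intro e
    induction e with
    | zero =>
      intro c hc u hu x hx
      have hc' := hc
      rw [Finsupp.degree_eq_zero_iff] at hc
      subst hc
      rw [hc', add_zero] at hu
      subst hu
      simpa using hg x hx
    | succ e ih =>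
      intro c' hc u hu x hx
      obtain ⟨j, hj⟩ : ∃ j, c' j ≠ 0 := by
        by_contra h
        push Not at h
        have : c' = 0 := by ext j; exact h j
        simp [this] at hc
      obtain ⟨c, rfl⟩ : ∃ c, c' = c + Finsupp.single j 1 := by
        refine ⟨c' - Finsupp.single j 1, ?_⟩
        rw [tsub_add_cancel_of_le]
        rw [Finsupp.single_le_iff]
        omega
      rw [map_add, Finsupp.degree_single] at hc hu
      have h1 := ih c (by omega) (u + 1) (by omega) _ (hX _ j _ hx)
      have h2 := Submodule.smul_mem K (MvPolynomial.X j)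
        (ih c (by omega) (u + 1) (by omega) x (hmono (by omega) hx))
      have h3 := Submodule.sub_mem _ h1 h2
      rw [Finset.smul_sum, ← Finset.sum_sub_distrib] at h3
      convert h3 using 1
      refine Finset.sum_congr rfl fun b _ => ?_
      by_cases hb : c ≤ β b
      · rw [if_pos hb, if_pos hb, dd_smul_X, smul_add, smul_comm (g b) (MvPolynomial.X j),
          add_sub_cancel_left]
        have hiff : 0 < (β b - c) j ↔ c + Finsupp.single j 1 ≤ β b := by
          rw [Finsupp.tsub_apply]
          constructor
          · intro h k
            have := hb k
            by_cases hk : j = k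
            · subst hk
              simp
              omega
            · simp [hk]
              exact this
          · intro h
            have := h j
            simp at this
            omega
        by_cases h : 0 < (β b - c) j
        · rw [if_pos h, if_pos (hiff.1 h), tsub_tsub]
        · rw [if_neg h, if_neg (fun h' => h (hiff.2 h')), smul_zero]
      · rw [if_neg hb, if_neg hb, smul_zero, sub_zero, if_neg]
        intro h
        exact hb (le_trans (by simp) h)
  exact main _ c rfl

theorem coeff_mem_of_op_kill
    (hK : DStable K)
    (hmono : Monotone W)
    (hX : ∀ i j m, m ∈ W i → (MvPolynomial.X j : MvPolynomial (Fin n) A) • m ∈ W (i + 1))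
    (hD : ∀ i b m, m ∈ W i → dd n A b m ∈ W (i + b.degree))
    (hP : ∀ a ∈ P, ∀ i, ∀ x ∈ W i, a • x ∈ K)
    (hm₀ : m₀ ∈ W w)
    (hm₁ : ∀ a, a • m₀ ∈ K → a ∈ P)
    {ι : Type} [Fintype ι] (β : ι → (Fin n →₀ ℕ))
    (hβ : Function.Injective β) (g : ι → MvPolynomial (Fin n) A) (e : ℕ)
    (he : ∀ b, (g b).totalDegree + (β b).degree ≤ e)
    (hg : ∀ x ∈ W (w + e), ∑ b, g b • dd n A (β b) x ∈ K) (b : ι) (s : Fin n →₀ ℕ) :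
    (g b).coeff s ∈ P := by
  classical
  by_contra hcon
  let T : Finset ι := Finset.univ.filter fun b => ∃ s, (g b).coeff s ∉ P
  have hT : T.Nonempty := ⟨b, by simp only [T, Finset.mem_filter, Finset.mem_univ, true_and]; exact ⟨s, hcon⟩⟩
  obtain ⟨b0, hb0, hb1⟩ := Finset.exists_max_image T (fun b => (β b).degree) hT
  have hg1 : ∀ x ∈ W (w + e), ∑ b ∈ T, g b • dd n A (β b) x ∈ K := by
    intro x hx
    have h1 := hg x hx
    rw [← Finset.sum_filter_add_sum_filter_not Finset.univ (fun b => ∃ s, (g b).coeff s ∉ P)] at h1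
    refine (Submodule.add_mem_iff_left _ ?_).1 h1
    apply Submodule.sum_mem
    intro b hb
    simp only [Finset.mem_filter, Finset.mem_univ, true_and, not_exists, not_not] at hb
    exact smul_mem_of_coeff hP _ hb _ _ (hD _ _ _ hx)
  have hle := he b0
  have h2 := comm_kill hmono hX T β g (w + e) hg1 (β b0)
  have h3 : ∀ x ∈ W (w + (e - (β b0).degree)), g b0 • x ∈ K := by
    intro x hx
    have h4 := h2 _ (by omega) x hx
    rw [Finset.sum_eq_single b0] at h4
    · simpa [dd_zero] using h4
    · intro b hb hne
      rw [if_neg]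
      intro hle
      apply hne
      have h5 := hb1 b hb
      apply hβ
      have h6 : β b - β b0 = 0 := by
        rw [← Finsupp.degree_eq_zero_iff]
        have : (β b - β b0).degree + (β b0).degree = (β b).degree := by
          rw [← map_add, tsub_add_cancel_of_le hle]
        omega
      exact le_antisymm (tsub_eq_zero_iff_le.1 h6) hle
    · intro h
      exact absurd hb0 h
  simp only [T, Finset.mem_filter, Finset.mem_univ, true_and] at hb0
  obtain ⟨s0, hs0⟩ := hb0
  exact hs0 (coeff_mem_of_kill hK hmono hD hP hm₀ hm₁ (g b0) _ (by omega) h3 s0)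

end Bern
end LCFin

end part4

section part5

set_option linter.unusedSimpArgs false
set_option linter.unusedSectionVars false

namespace LCFin

open Finset

variable {A : Type u} [CommRing A] {n : ℕ}

theorem exists_generators (r : ℕ) : ∀ (U : Type u) [AddCommGroup U] [Module A U],
    Module.length A U ≤ r → ∃ g : Fin r → U, Submodule.span A (Set.range g) = ⊤ := by
  induction r with
  | zero =>
    intro U _ _ h
    have : Module.length A U = 0 := by simpa using h
    rw [Module.length_eq_zero_iff] at this
    exact ⟨fun _ => 0, Subsingleton.elim _ _⟩
  | succ r ih =>
    intro U _ _ h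
    by_cases hU : Subsingleton U
    · exact ⟨fun _ => 0, Subsingleton.elim _ _⟩
    · rw [not_subsingleton_iff_nontrivial] at hU
      obtain ⟨u, hu⟩ := exists_ne (0 : U)
      let S := Submodule.span A {u}
      have h1 := Module.length_eq_add_of_exact S.subtype S.mkQ (Submodule.subtype_injective _)
        (Submodule.mkQ_surjective _) (LinearMap.exact_subtype_mkQ S)
      have h2 : 1 ≤ Module.length A S := by
        rw [Order.one_le_iff_ne_zero, Ne, Module.length_eq_zero_iff]
        intro h3
        apply hu
        have := Subsingleton.elim (⟨u, Submodule.mem_span_singleton_self u⟩ : S) 0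
        exact congrArg Subtype.val this
      have h3 : Module.length A (U ⧸ S) ≤ r := by
        rw [h1] at h
        have : 1 + Module.length A (U ⧸ S) ≤ 1 + (r : ℕ∞) := by
          refine (add_le_add h2 le_rfl).trans (h.trans ?_)
          push_cast
          rw [add_comm]
        exact (ENat.add_le_add_iff_left (by simp)).1 this
      obtain ⟨g, hg⟩ := ih _ h3
      choose g' hg' using fun i => Submodule.mkQ_surjective S (g i)
      refine ⟨Fin.cons u g', ?_⟩
      rw [eq_top_iff]
      intro x _
      have hx : S.mkQ x ∈ (Submodule.span A (Set.range g')).map S.mkQ := by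
        rw [Submodule.map_span, ← Set.range_comp]
        have : S.mkQ ∘ g' = g := funext hg'
        rw [this, hg]
        trivial
      obtain ⟨y, hy, hxy⟩ := hx
      have h4 : x - y ∈ S := by
        rw [← Submodule.ker_mkQ S, LinearMap.mem_ker, map_sub, hxy, sub_self]
      have h5 : x = y + (x - y) := by abel
      rw [h5]
      apply Submodule.add_mem
      · refine Submodule.span_mono ?_ hy
        rintro _ ⟨i, rfl⟩
        exact ⟨i.succ, by simp⟩
      · refine Submodule.span_mono ?_ h4
        rintro _ rfl
        exact ⟨0, by simp⟩

/-- The multi-index attached to a bounded function. -/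
noncomputable def bIdx {j : ℕ} (a : Fin n → Fin (j + 1)) : Fin n →₀ ℕ :=
  Finsupp.equivFunOnFinite.symm fun k => (a k : ℕ)

theorem bIdx_apply {j : ℕ} (a : Fin n → Fin (j + 1)) (k) : bIdx a k = a k := rfl

theorem bIdx_injective {j : ℕ} : Function.Injective (bIdx (n := n) (j := j)) := by
  intro a b h
  funext k
  apply Fin.ext
  exact DFunLike.congr_fun h k

theorem bIdx_degree {j : ℕ} (a : Fin n → Fin (j + 1)) : (bIdx a).degree ≤ n * j := by
  rw [Finsupp.degree_eq_sum]
  refine (Finset.sum_le_card_nsmul _ _ j fun k _ => ?_).trans (by simp)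
  rw [bIdx_apply]
  omega

section Bern

variable {M : Type u} [AddCommGroup M]
    [Module (MvPolynomial (Fin n) A) M] [DStr n A M] [Module A M]
    [IsScalarTower A (MvPolynomial (Fin n) A) M]
    {K : Submodule (MvPolynomial (Fin n) A) M} (hK : DStable K) {W : ℕ → Submodule A M}
    (hmono : Monotone W)
    (hX : ∀ i j m, m ∈ W i → (MvPolynomial.X j : MvPolynomial (Fin n) A) • m ∈ W (i + 1))
    (hD : ∀ i b m, m ∈ W i → dd n A b m ∈ W (i + b.degree))
    {P : Ideal A} (hP : ∀ a ∈ P, ∀ i, ∀ x ∈ W i, a • x ∈ K)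
    {w : ℕ} {m₀ : M} (hm₀ : m₀ ∈ W w) (hm₁ : ∀ a, a • m₀ ∈ K → a ∈ P)

variable (K W) in
/-- The image of `W i` in the quotient. -/
noncomputable abbrev UU (i : ℕ) : Submodule A (M ⧸ K.restrictScalars A) :=
  (W i).map (K.restrictScalars A).mkQ

theorem monomial_mem_W
    (hX : ∀ i j m, m ∈ W i → (MvPolynomial.X j : MvPolynomial (Fin n) A) • m ∈ W (i + 1))
    (s : Fin n →₀ ℕ) : ∀ (w : ℕ) (m : M), m ∈ W w →
    (MvPolynomial.monomial s (1 : A)) • m ∈ W (w + s.degree) := by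
  induction s using Finsupp.induction_linear with
  | zero =>
    intro w m hm
    have : (MvPolynomial.monomial (0 : Fin n →₀ ℕ) (1 : A)) = 1 := rfl
    simpa [this] using hm
  | add s t hs ht =>
    intro w m hm
    have : (MvPolynomial.monomial (s + t) (1 : A)) = MvPolynomial.monomial t 1 *
        MvPolynomial.monomial s 1 := by
      rw [MvPolynomial.monomial_mul, mul_one, add_comm]
    rw [this, mul_smul, map_add, ← add_assoc]
    exact ht _ _ (hs _ _ hm)
  | single j k =>
    intro w m hm
    have : (MvPolynomial.monomial (Finsupp.single j k) (1 : A)) = MvPolynomial.X j ^ k := by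
      rw [MvPolynomial.X_pow_eq_monomial]
    rw [this, Finsupp.degree_single]
    clear this
    induction k with
    | zero => simpa using hm
    | succ k ih =>
      rw [pow_succ', mul_smul, ← add_assoc]
      exact hX _ _ _ ih

theorem bern_count
    (hK : DStable K)
    (hmono : Monotone W)
    (hX : ∀ i j m, m ∈ W i → (MvPolynomial.X j : MvPolynomial (Fin n) A) • m ∈ W (i + 1))
    (hD : ∀ i b m, m ∈ W i → dd n A b m ∈ W (i + b.degree))
    (hP : ∀ a ∈ P, ∀ i, ∀ x ∈ W i, a • x ∈ K)
    (hm₀ : m₀ ∈ W w)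
    (hm₁ : ∀ a, a • m₀ ∈ K → a ∈ P)
    [P.IsMaximal] (j : ℕ) (r : ℕ)
    (hr : Module.length A (UU K W (w + 2 * n * j)) ≤ r) :
    (((j + 1) ^ (2 * n) : ℕ) : ℕ∞) ≤ r * Module.length A (UU K W (w + 4 * n * j)) := by
  classical
  obtain ⟨g, hg⟩ := exists_generators r _ hr
  choose x hx hgx using fun l => (g l).2
  let ι := (Fin n → Fin (j + 1)) × (Fin n → Fin (j + 1))
  let op : ι → M →ₗ[A] M := fun p =>
    { toFun := fun m => MvPolynomial.monomial (bIdx p.1) (1 : A) • dd n A (bIdx p.2) m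
      map_add' := fun m m' => by rw [dd_add, smul_add]
      map_smul' := fun a m => by
        rw [dd_smul_A, RingHom.id_apply, smul_comm] }
  have hop : ∀ p m, m ∈ W (w + 2 * n * j) → op p m ∈ W (w + 4 * n * j) := by
    intro p m hm
    refine hmono ?_ (monomial_mem_W hX (bIdx p.1) _ _ (hD _ (bIdx p.2) _ hm))
    have h1 := bIdx_degree p.1
    have h2 := bIdx_degree p.2
    nlinarith
  -- the evaluation map
  let ev : (ι → A) →ₗ[A] (Fin r → UU K W (w + 4 * n * j)) :=
    LinearMap.pi fun l => ∑ p, (LinearMap.proj p : (ι → A) →ₗ[A] A).smulRight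
      (⟨(K.restrictScalars A).mkQ (op p (x l)), ⟨_, hop p _ (hx l), rfl⟩⟩ :
        UU K W (w + 4 * n * j))
  let q : (ι → A) →ₗ[A] (ι → A ⧸ P) :=
    LinearMap.pi fun p => (Submodule.mkQ P).comp (LinearMap.proj p)
  have hq : Function.Surjective q := by
    intro y
    choose z hz using fun p => Submodule.mkQ_surjective P (y p)
    exact ⟨z, funext hz⟩
  have hker : LinearMap.ker ev ≤ LinearMap.ker q := by
    intro c hc
    have hc1 : ∀ l, ∑ p, c p • op p (x l) ∈ K := by
      intro l
      have h1 := congrArg Subtype.val (congrFun (LinearMap.mem_ker.1 hc) l)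
      have h2 : (K.restrictScalars A).mkQ (∑ p, c p • op p (x l)) = 0 := by
        rw [map_sum]
        refine Eq.trans ?_ h1
        simp [ev]
      rwa [← LinearMap.mem_ker, Submodule.ker_mkQ] at h2
    let Op : M →ₗ[A] M := ∑ p, c p • op p
    have hOp : ∀ m, Op m = ∑ p, c p • op p m := by
      intro m; simp [Op]
    have hOpK : ∀ m ∈ K, Op m ∈ K := by
      intro m hm
      rw [hOp]
      apply Submodule.sum_mem
      intro p _
      rw [← C_smul' (n := n)]
      exact Submodule.smul_mem _ _ (Submodule.smul_mem _ _ (hK _ _ hm))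
    have hc2 : ∀ m ∈ W (w + 2 * n * j), Op m ∈ K := by
      intro m hm
      have h1 : (⟨(K.restrictScalars A).mkQ m, ⟨m, hm, rfl⟩⟩ : UU K W (w + 2 * n * j)) ∈
        Submodule.span A (Set.range g) := by rw [hg]; trivial
      rw [Submodule.mem_span_range_iff_exists_fun] at h1
      obtain ⟨a, ha⟩ := h1
      have h2 := congrArg Subtype.val ha
      have h3 : m - ∑ l, a l • x l ∈ K := by
        change m - ∑ l, a l • x l ∈ K.restrictScalars A
        rw [← Submodule.ker_mkQ (K.restrictScalars A), LinearMap.mem_ker, map_sub, map_sum,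
          sub_eq_zero]
        refine h2.symm.trans ?_
        simp [hgx]
      have h4 : Op m = Op (m - ∑ l, a l • x l) + ∑ l, a l • Op (x l) := by
        rw [map_sub, map_sum]
        simp
      rw [h4]
      apply Submodule.add_mem _ (hOpK _ h3)
      apply Submodule.sum_mem
      intro l _
      rw [← C_smul' (n := n), hOp]
      exact Submodule.smul_mem _ _ (hc1 l)
    let gg : (Fin n → Fin (j + 1)) → MvPolynomial (Fin n) A := fun b =>
      ∑ a, MvPolynomial.monomial (bIdx a) (c (a, b))
    have hgg : ∀ a b, (gg b).coeff (bIdx a) = c (a, b) := by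
      intro a b
      simp only [gg, MvPolynomial.coeff_sum, MvPolynomial.coeff_monomial]
      rw [Finset.sum_eq_single a]
      · simp
      · intro a' _ h
        rw [if_neg (fun h' => h (bIdx_injective h'))]
      · simp
    have hfin := coeff_mem_of_op_kill hK hmono hX hD hP hm₀ hm₁ (fun b => bIdx b)
      bIdx_injective gg (2 * n * j) ?_ ?_
    · rw [LinearMap.mem_ker]
      funext p
      have := hfin p.2 (bIdx p.1)
      rw [hgg] at this
      change Submodule.mkQ P (c p) = 0
      rwa [← LinearMap.mem_ker, Submodule.ker_mkQ]
    · intro b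
      have h1 := bIdx_degree b
      have h2 : (gg b).totalDegree ≤ n * j := by
        refine (MvPolynomial.totalDegree_finsetSum _ _).trans ?_
        apply Finset.sup_le
        intro a _
        refine (MvPolynomial.totalDegree_monomial_le _ _).trans ?_
        exact bIdx_degree a
      nlinarith
    · intro m hm
      convert hc2 m hm using 1
      rw [hOp, Fintype.sum_prod_type_right]
      apply Finset.sum_congr rfl
      intro b _
      rw [Finset.sum_smul]
      apply Finset.sum_congr rfl
      intro a _
      change _ = c (a, b) • (MvPolynomial.monomial (bIdx a) (1 : A) • dd n A (bIdx b) m)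
      rw [← C_smul' (n := n) (c (a, b)), smul_smul, MvPolynomial.C_mul_monomial, mul_one]
  have hsimp : IsSimpleModule A (A ⧸ P) := by
    rw [isSimpleModule_iff_isCoatom]
    exact Ideal.IsMaximal.out
  have l1 : Module.length A (ι → A ⧸ P) = ((j + 1) ^ (2 * n) : ℕ) := by
    rw [Module.length_pi, Module.length_eq_one, mul_one, ENat.card_eq_coe_fintype_card]
    congr 1
    simp [ι]
    ring
  rw [← l1]
  have l2 : Module.length A (ι → A ⧸ P) ≤ Module.length A ((ι → A) ⧸ LinearMap.ker ev) := by
    apply Module.length_le_of_surjective ((LinearMap.ker ev).liftQ q hker)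
    intro y
    obtain ⟨z, hz⟩ := hq y
    exact ⟨Submodule.Quotient.mk z, by simpa using hz⟩
  refine l2.trans ?_
  refine (Module.length_le_of_injective ((LinearMap.ker ev).liftQ ev le_rfl) ?_).trans ?_
  · rw [← LinearMap.ker_eq_bot]
    exact Submodule.ker_liftQ_eq_bot _ _ _ le_rfl
  · rw [Module.length_pi, ENat.card_eq_coe_fintype_card, Fintype.card_fin]

end Bern
end LCFin

end part5

section part6

set_option linter.unusedSimpArgs false
set_option linter.unusedSectionVars false

namespace LCFin

open Finset

variable {A : Type u} [CommRing A] {n : ℕ}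

section Chain

variable {M : Type u} [AddCommGroup M]
    [Module (MvPolynomial (Fin n) A) M] [DStr n A M] [Module A M]
    [IsScalarTower A (MvPolynomial (Fin n) A) M]

/-- The length of the `i`-th filtration step of a submodule. -/
noncomputable def lam (G : Filt n A M) (K : Submodule (MvPolynomial (Fin n) A) M) (i : ℕ) : ℕ∞ :=
  Module.length A (G.F i ⊓ K.restrictScalars A : Submodule A M)

theorem lam_le (G : Filt n A M) (K : Submodule (MvPolynomial (Fin n) A) M) (i : ℕ) :
    lam G K i ≤ (G.C * (i + 1) ^ n : ℕ) :=
  (Module.length_le_of_injective (Submodule.inclusion inf_le_left)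
    (Submodule.inclusion_injective _)).trans (G.len i)

theorem bernstein [IsArtinianRing A] (G : Filt n A M) {K K' : Submodule (MvPolynomial (Fin n) A) M}
    (hK : DStable K) (hK' : DStable K') (h : K < K') :
    ∃ w, ∀ w' ≥ w, ∀ j, lam G K (w' + 4 * n * j) + ((j + 1) ^ n : ℕ) ≤
      lam G K' (w' + 4 * n * j) := by
  classical
  let KA := K.restrictScalars A
  let S : Submodule A (M ⧸ KA) := (K'.restrictScalars A).map KA.mkQ
  have hS : Nontrivial S := by
    obtain ⟨x, hx, hx2⟩ := SetLike.exists_of_lt h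
    refine ⟨⟨⟨KA.mkQ x, x, hx, rfl⟩, 0, ?_⟩⟩
    intro h0
    have := congrArg Subtype.val h0
    have h1 : KA.mkQ x = 0 := this
    rw [← LinearMap.mem_ker, Submodule.ker_mkQ] at h1
    exact hx2 h1
  obtain ⟨P, hP⟩ := associatedPrimes.nonempty A S
  have hPp : P.IsPrime := hP.1
  obtain ⟨_, ⟨_, m₀, hm₀, rfl⟩, hm₁⟩ := isAssociatedPrime_iff.1 hP
  have hPmax : P.IsMaximal := inferInstance
  have hm₂ : ∀ a, a ∈ P ↔ a • m₀ ∈ K := by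
    intro a
    rw [hm₁, Submodule.mem_colon_singleton, Submodule.mem_bot, ← Submodule.coe_eq_zero]
    change a • KA.mkQ m₀ = 0 ↔ _
    rw [← map_smul, ← LinearMap.mem_ker, Submodule.ker_mkQ]
    rfl
  let W : ℕ → Submodule A M := fun i => G.F i ⊓ (K'.restrictScalars A ⊓
    { carrier := {x | ∀ a ∈ P, a • x ∈ K}
      zero_mem' := fun a _ => by simp
      add_mem' := fun hx hy a ha => by
        rw [smul_add]
        exact K.add_mem (hx a ha) (hy a ha)
      smul_mem' := fun c x hx a ha => by
        rw [smul_comm, ← C_smul' (n := n) c]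
        exact K.smul_mem _ (hx a ha) })
  have hmono : Monotone W := fun i j h => inf_le_inf_right _ (G.mono h)
  have hX : ∀ i j m, m ∈ W i → (MvPolynomial.X j : MvPolynomial (Fin n) A) • m ∈ W (i + 1) := by
    rintro i j m ⟨h1, h2, h3⟩
    refine ⟨G.X_mem _ _ _ h1, K'.smul_mem _ h2, ?_⟩
    intro a ha
    rw [smul_comm]
    exact K.smul_mem _ (h3 a ha)
  have hD : ∀ i b m, m ∈ W i → dd n A b m ∈ W (i + b.degree) := by
    rintro i b m ⟨h1, h2, h3⟩
    refine ⟨G.dd_mem _ _ _ h1, hK' _ _ h2, ?_⟩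
    intro a ha
    rw [← dd_smul_A]
    exact hK _ _ (h3 a ha)
  have hPW : ∀ a ∈ P, ∀ i, ∀ x ∈ W i, a • x ∈ K := fun a ha i x hx => hx.2.2 a ha
  obtain ⟨w, hw⟩ := G.exh m₀
  have hmw : m₀ ∈ W w := ⟨hw, hm₀, fun a ha => (hm₂ a).1 ha⟩
  have key : ∀ i, lam G K i + Module.length A (UU K W i) ≤ lam G K' i := by
    intro i
    let ψ : (G.F i ⊓ K'.restrictScalars A : Submodule A M) →ₗ[A] M ⧸ KA :=
      KA.mkQ.comp (Submodule.subtype _)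
    have e1 : lam G K' i = Module.length A (LinearMap.ker ψ) + Module.length A (LinearMap.range ψ) :=
      Module.length_eq_add_of_exact (LinearMap.ker ψ).subtype ψ.rangeRestrict
        (Submodule.subtype_injective _) ψ.surjective_rangeRestrict (by
          rw [LinearMap.exact_iff, LinearMap.ker_rangeRestrict, Submodule.range_subtype])
    rw [e1]
    apply add_le_add
    · have hle : G.F i ⊓ K.restrictScalars A ≤ G.F i ⊓ K'.restrictScalars A :=
        inf_le_inf_left _ h.le
      refine Module.length_le_of_injective (LinearMap.codRestrict _ (Submodule.inclusion hle) ?_) ?_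
      · intro x
        rw [LinearMap.mem_ker]
        change KA.mkQ x.1 = 0
        rw [← LinearMap.mem_ker, Submodule.ker_mkQ]
        exact x.2.2
      · intro x y hxy
        have := congrArg (fun z => z.1.1) hxy
        exact Subtype.ext this
    · have hle : UU K W i ≤ LinearMap.range ψ := by
        rintro _ ⟨x, hx, rfl⟩
        exact ⟨⟨x, hx.1, hx.2.1⟩, rfl⟩
      exact Module.length_le_of_injective (Submodule.inclusion hle)
        (Submodule.inclusion_injective _)
  have hfin : ∀ i, ∃ l : ℕ, Module.length A (UU K W i) = l := by
    intro i
    have : Module.length A (UU K W i) ≤ (G.C * (i + 1) ^ n : ℕ) :=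
      le_add_self.trans ((key i).trans (lam_le G K' i))
    exact ENat.ne_top_iff_exists.1 (ne_top_of_le_ne_top (ENat.natCast_ne_top _) this) |>.imp
      fun _ h => h.symm
  refine ⟨w, fun w' hw' j => ?_⟩
  refine le_trans (add_le_add le_rfl ?_) (key _)
  obtain ⟨r, hr⟩ := hfin (w' + 2 * n * j)
  obtain ⟨l, hl⟩ := hfin (w' + 4 * n * j)
  have hcount := bern_count hK hmono hX hD hPW (hmono hw' hmw) (fun a => (hm₂ a).2) j r hr.le
  rw [hl] at hcount ⊢
  have hrl : r ≤ l := by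
    have : Module.length A (UU K W (w' + 2 * n * j)) ≤ Module.length A (UU K W (w' + 4 * n * j)) :=
      Module.length_le_of_injective (Submodule.inclusion (Submodule.map_mono (hmono (by nlinarith))))
        (Submodule.inclusion_injective _)
    rw [hr, hl] at this
    exact_mod_cast this
  norm_cast at hcount ⊢
  have h2 : ((j + 1) ^ n) ^ 2 ≤ l ^ 2 := by
    rw [← pow_mul, mul_comm n 2, sq]
    exact hcount.trans (Nat.mul_le_mul_right _ hrl)
  exact (Nat.pow_le_pow_iff_left (by norm_num)).1 h2

theorem chain_bound [IsArtinianRing A] (G : Filt n A M)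
    (K : ℕ → Submodule (MvPolynomial (Fin n) A) M) (hK : ∀ i, DStable (K i)) (N : ℕ)
    (h : ∀ i < N, K i < K (i + 1)) : N ≤ G.C * (4 * n + 1) ^ n := by
  have h1 : ∀ N' ≤ N, ∃ w, ∀ w' ≥ w, ∀ j,
      ((N' * (j + 1) ^ n : ℕ) : ℕ∞) ≤ lam G (K N') (w' + 4 * n * j) := by
    intro N'
    induction N' with
    | zero =>
      intro _
      exact ⟨0, by simp⟩
    | succ N' ih =>
      intro hN'
      obtain ⟨w, hw⟩ := ih (by omega)
      obtain ⟨v, hv⟩ := bernstein G (hK N') (hK (N' + 1)) (h N' (by omega))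
      refine ⟨w + v, fun w' hw' j => ?_⟩
      refine le_trans ?_ (hv w' (by omega) j)
      refine le_trans ?_ (add_le_add (hw w' (by omega) j) le_rfl)
      norm_cast
      apply le_of_eq
      ring
  obtain ⟨w, hw⟩ := h1 N le_rfl
  have h2 := (hw w le_rfl w).trans (lam_le G _ _)
  norm_cast at h2
  have h3 : G.C * (w + 4 * n * w + 1) ^ n ≤ G.C * (4 * n + 1) ^ n * (w + 1) ^ n := by
    rw [mul_assoc G.C ((4 * n + 1) ^ n), ← mul_pow]
    gcongr
    nlinarith
  exact Nat.le_of_mul_le_mul_right (h2.trans h3) (by positivity)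

end Chain
end LCFin

end part6

section part7

set_option linter.unusedSimpArgs false
set_option linter.unusedSectionVars false

namespace LCFin

open Finset

variable {A : Type u} [CommRing A] {n : ℕ}

/-- Associated primes of the subquotient `K2 / K1`. -/
def AssRel {R : Type u} [CommRing R] {M : Type u} [AddCommGroup M] [Module R M]
    (K1 K2 : Submodule R M) : Set (Ideal R) :=
  {P | P.IsPrime ∧ ∃ m ∈ K2, ∀ r, r ∈ P ↔ r • m ∈ K1}

theorem assRel_subset {R : Type u} [CommRing R] {M : Type u} [AddCommGroup M] [Module R M]
    (K1 N K2 : Submodule R M) (h1 : K1 ≤ N) : AssRel K1 K2 ⊆ AssRel K1 N ∪ AssRel N K2 := by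
  rintro P ⟨hP, m, hm, hPm⟩
  by_cases h : ∃ s, s ∉ P ∧ s • m ∈ N
  · obtain ⟨s, hs, hsm⟩ := h
    left
    refine ⟨hP, s • m, hsm, fun r => ?_⟩
    rw [smul_smul, ← hPm]
    exact ⟨fun h => P.mul_mem_right _ h, fun h => (hP.mem_or_mem h).resolve_right hs⟩
  · right
    refine ⟨hP, m, hm, fun r => ⟨fun h => h1 ((hPm r).1 h), fun h' => ?_⟩⟩
    by_contra h3
    exact h ⟨r, h3, h'⟩

section
variable {M : Type u} [AddCommGroup M]
    [Module (MvPolynomial (Fin n) A) M] [DStr n A M]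

theorem pow_dd_mem {K : Submodule (MvPolynomial (Fin n) A) M} (hK : DStable K)
    (p : MvPolynomial (Fin n) A) (t : ℕ) : ∀ x : M, p ^ t • x ∈ K →
      ∀ (e : ℕ) (b : Fin n →₀ ℕ), b.degree = e → p ^ (t + e) • dd n A b x ∈ K := by
  induction t with
  | zero =>
    intro x hx e b hb
    rw [pow_zero, one_smul] at hx
    exact K.smul_mem _ (hK _ _ hx)
  | succ t ih =>
    intro x hx e
    have ih2 := ih (p • x) (by rw [smul_smul, ← pow_succ]; exact hx)
    induction e using Nat.strong_induction_on with
    | _ e ihe =>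
      intro b hb
      have e1 : p ^ (t + 1 + e) • dd n A b x = p ^ (t + e) • (p • dd n A b x) := by
        rw [smul_smul, ← pow_succ]; congr 2; ring
      rw [e1, smul_dd, smul_sub, Finset.smul_sum]
      apply Submodule.sub_mem
      · exact ih2 e b hb
      · apply Submodule.sum_mem
        intro y hy
        have hy := mem_erase_antidiagonal hy
        have h1 := ihe y.2.degree (by omega) y.2 rfl
        have h2 : p ^ (t + e) • hs y.1 p • dd n A y.2 x =
            (p ^ (e - 1 - y.2.degree) * hs y.1 p) • (p ^ (t + 1 + y.2.degree) • dd n A y.2 x) := by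
          rw [smul_smul, smul_smul]
          congr 1
          have : t + e = (e - 1 - y.2.degree) + (t + 1 + y.2.degree) := by omega
          rw [this]
          ring
        rw [h2]
        exact K.smul_mem _ h1

theorem assRel_subsingleton {K N : Submodule (MvPolynomial (Fin n) A) M} (hK : DStable K)
    (hN : DStable N) (hKN : K < N) (hmin : ∀ T, DStable T → K < T → T ≤ N → T = N) :
    (AssRel K N).Subsingleton := by
  have key : ∀ P ∈ AssRel K N, ∀ Q ∈ AssRel K N, P ≤ Q := by
    rintro P ⟨hP, m, hm, hPm⟩ Q ⟨hQ, m', hm', hQm⟩ p hp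
    let T : Submodule (MvPolynomial (Fin n) A) M :=
      { carrier := {x | x ∈ N ∧ ∃ t, p ^ t • x ∈ K}
        zero_mem' := ⟨N.zero_mem, 0, by simp⟩
        add_mem' := by
          rintro x y ⟨hx, t, ht⟩ ⟨hy, t', ht'⟩
          refine ⟨N.add_mem hx hy, t + t', ?_⟩
          rw [smul_add]
          apply K.add_mem
          · rw [add_comm, pow_add, mul_smul]
            exact K.smul_mem _ ht
          · rw [pow_add, mul_smul]
            exact K.smul_mem _ ht'
        smul_mem' := by
          rintro c x ⟨hx, t, ht⟩
          refine ⟨N.smul_mem _ hx, t, ?_⟩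
          rw [smul_comm]
          exact K.smul_mem _ ht }
    have hT : DStable T := by
      rintro b x ⟨hx, t, ht⟩
      exact ⟨hN _ _ hx, t + b.degree, pow_dd_mem hK p t x ht _ b rfl⟩
    have hTN : T = N := by
      apply hmin T hT
      · refine lt_of_le_of_ne ?_ ?_
        · intro x hx
          exact ⟨hKN.le hx, 0, by simpa using hx⟩
        · intro h
          have hmT : m ∈ T := ⟨hm, 1, by rw [pow_one]; exact (hPm p).1 hp⟩
          rw [← h] at hmT
          exact hP.ne_top ((Ideal.eq_top_iff_one P).2 ((hPm 1).2 (by simpa using hmT)))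
      · intro x hx
        exact hx.1
    have : m' ∈ T := by rw [hTN]; exact hm'
    obtain ⟨_, t, ht⟩ := this
    exact hQ.mem_of_pow_mem t ((hQm _).2 ht)
  intro P hP Q hQ
  exact le_antisymm (key P hP Q hQ) (key Q hQ P hP)

theorem assRel_finite [IsArtinianRing A] (hG : GrowthR n A M)
    (K1 K2 : Submodule (MvPolynomial (Fin n) A) M) (h1 : DStable K1) (h2 : DStable K2)
    (h12 : K1 ≤ K2) : (AssRel K1 K2).Finite := by
  let _ := Module.compHom M (algebraMap A (MvPolynomial (Fin n) A))
  have : IsScalarTower A (MvPolynomial (Fin n) A) M := isScalarTower_compHom M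
  obtain ⟨G⟩ := @hG _ _
  let L := {K : Submodule (MvPolynomial (Fin n) A) M // DStable K}
  have wgt : WellFounded fun a b : L => b < a := by
    rw [RelEmbedding.wellFounded_iff_isEmpty]
    refine ⟨fun f => ?_⟩
    have hf : ∀ i, f i < f (i + 1) := fun i => f.map_rel_iff.2 (Nat.lt_succ_self i)
    have := chain_bound G (fun i => (f i).1) (fun i => (f i).2) (G.C * (4 * n + 1) ^ n + 1)
      (fun i _ => hf i)
    omega
  have wlt : WellFounded fun a b : L => a < b := by
    rw [RelEmbedding.wellFounded_iff_isEmpty]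
    refine ⟨fun f => ?_⟩
    have hf : ∀ i, f (i + 1) < f i := fun i => f.map_rel_iff.2 (Nat.lt_succ_self i)
    have := chain_bound G (fun i => (f (G.C * (4 * n + 1) ^ n + 1 - i)).1) (fun i => (f _).2)
      (G.C * (4 * n + 1) ^ n + 1) (fun i hi => by
        have := hf (G.C * (4 * n + 1) ^ n + 1 - (i + 1))
        have e : G.C * (4 * n + 1) ^ n + 1 - (i + 1) + 1 = G.C * (4 * n + 1) ^ n + 1 - i := by
          omega
        rw [e] at this
        exact this)
    omega
  have main : ∀ K : L, K.1 ≤ K2 → (AssRel K.1 K2).Finite := by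
    intro K
    induction K using wgt.induction with
    | _ K ih =>
      intro hK
      rcases hK.eq_or_lt with heq | hlt
      · rw [heq]
        convert Set.finite_empty
        rw [Set.eq_empty_iff_forall_notMem]
        rintro P ⟨hP, m, hm, hPm⟩
        exact hP.ne_top ((Ideal.eq_top_iff_one P).2 ((hPm 1).2 (by simpa using hm)))
      · obtain ⟨N, ⟨hN1, hN2⟩, hN3⟩ := wlt.has_min {N : L | K < N ∧ N.1 ≤ K2}
          ⟨⟨K2, h2⟩, hlt, le_rfl⟩
        have h3 : (AssRel K.1 N.1).Subsingleton := by
          apply assRel_subsingleton K.2 N.2 hN1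
          intro T hT hKT hTN
          by_contra hne
          exact hN3 ⟨T, hT⟩ ⟨hKT, hTN.trans hN2⟩ (lt_of_le_of_ne hTN (fun h => hne (congrArg Subtype.val h)))
        exact (h3.finite.union (ih N hN1 hN2)).subset (assRel_subset _ _ _ hN1.le)
  exact main ⟨K1, h1⟩ h12

end
end LCFin

end part7

section part8

set_option linter.unusedSimpArgs false
set_option linter.unusedSectionVars false

namespace LCFin
section oldExt
open Opposite
variable {R : Type u} [CommRing R] (M : ModuleCat.{u} R) (i : ℕ)

/-- The contravariant Hom functor into `M`, viewed as a covariant functor to the opposite. -/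
noncomputable abbrev homOp : ModuleCat.{u} R ⥤ (ModuleCat.{u} R)ᵒᵖ :=
  ((linearYoneda R (ModuleCat.{u} R)).obj M).rightOp

/-- Old-style Ext. -/
noncomputable abbrev OExt (X : ModuleCat.{u} R) : ModuleCat.{u} R :=
  (((homOp M).leftDerived i).obj X).unop

/-- Functoriality in the first variable. -/
noncomputable abbrev OExtMap {X Y : ModuleCat.{u} R} (g : X ⟶ Y) : OExt M i Y ⟶ OExt M i X :=
  (((homOp M).leftDerived i).map g).unop

/-- Hom complex. -/
noncomputable abbrev KP {X : ModuleCat.{u} R} (P : ProjectiveResolution X) :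
    ChainComplex (ModuleCat.{u} R)ᵒᵖ ℕ :=
  ((homOp M).mapHomologicalComplex (ComplexShape.down ℕ)).obj P.complex

/-- a cochain as a morphism in the opposite category -/
noncomputable def toK {Y : ModuleCat.{u} R} (f : Y ⟶ M) :
    (homOp M).obj Y ⟶ op (ModuleCat.of R R) :=
  (ModuleCat.ofHom (LinearMap.toSpanSingleton R (Y ⟶ M) f)).op

lemma toK_comp {Y Z : ModuleCat.{u} R} (g : Z ⟶ Y) (f : Y ⟶ M) :
    (homOp M).map g ≫ toK M f = toK M (g ≫ f) := by
  apply Quiver.Hom.unop_inj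
  ext
  change g ≫ ((1 : R) • f) = (1 : R) • (g ≫ f)
  simp

lemma toK_zero {Y : ModuleCat.{u} R} : toK M (0 : Y ⟶ M) = 0 := by
  apply Quiver.Hom.unop_inj
  ext
  change (1 : R) • (0 : Y ⟶ M) = 0
  simp

lemma toK_surj {Y : ModuleCat.{u} R} (k : (homOp M).obj Y ⟶ op (ModuleCat.of R R)) :
    ∃ f, toK M f = k := by
  refine ⟨k.unop.hom (1 : R), ?_⟩
  apply Quiver.Hom.unop_inj
  ext
  exact one_smul R _

lemma toK_inj {Y : ModuleCat.{u} R} {f g : Y ⟶ M} (h : toK M f = toK M g) : f = g := by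
  have h1 := congrArg (fun k => k.unop.hom (1 : R)) h
  exact (one_smul R f).symm.trans (h1.trans (one_smul R g))

lemma toK_add {Y : ModuleCat.{u} R} (f g : Y ⟶ M) : toK M (f + g) = toK M f + toK M g := by
  apply Quiver.Hom.unop_inj
  ext
  exact smul_add (1 : R) f g

variable {M i}

/-- typed wrapper -/
noncomputable def isoLD {X : ModuleCat.{u} R} (P : ProjectiveResolution X) :
    ((homOp M).leftDerived i).obj X ≅ (KP M P).homology i :=
  P.isoLeftDerivedObj (homOp M) i

/-- typed wrapper -/
noncomputable def KPmap {X Y : ModuleCat.{u} R} {P : ProjectiveResolution X}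
    {Q : ProjectiveResolution Y} (φ : P.complex ⟶ Q.complex) : KP M P ⟶ KP M Q :=
  ((homOp M).mapHomologicalComplex (ComplexShape.down ℕ)).map φ

lemma isoLD_nat {X Y : ModuleCat.{u} R} (P : ProjectiveResolution X)
    (Q : ProjectiveResolution Y) (g : X ⟶ Y) (φ : ProjectiveResolution.Hom P Q g) :
    ((homOp M).leftDerived i).map g ≫ (isoLD Q).hom =
      (isoLD P).hom ≫ HomologicalComplex.homologyMap (KPmap (M := M) φ.hom) i :=
  P.isoLeftDerivedObj_hom_naturality g Q φ.hom
    (by simpa using φ.hom_f_zero_comp_π_f_zero) (homOp M) i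

/-- typed wrapper -/
noncomputable def toKX {X : ModuleCat.{u} R} (P : ProjectiveResolution X)
    (f : P.complex.X i ⟶ M) : (KP M P).X i ⟶ op (ModuleCat.of R R) := toK M f

lemma toKX_d {X : ModuleCat.{u} R} (P : ProjectiveResolution X)
    {j : ℕ} (f : P.complex.X i ⟶ M) :
    (KP M P).d j i ≫ toKX P f = toKX P (P.complex.d j i ≫ f) := toK_comp M _ _

lemma toKX_cocycle {X : ModuleCat.{u} R} (P : ProjectiveResolution X)
    (f : P.complex.X i ⟶ M) {j : ℕ} (hf : P.complex.d j i ≫ f = 0) :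
    (KP M P).d j i ≫ toKX P f = 0 := by
  rw [toKX_d, hf]
  exact toK_zero M

lemma toKX_surj {X : ModuleCat.{u} R} (P : ProjectiveResolution X)
    (k : (KP M P).X i ⟶ op (ModuleCat.of R R)) :
    ∃ f, toKX P f = k := toK_surj M k

lemma toKX_inj {X : ModuleCat.{u} R} (P : ProjectiveResolution X)
    {f g : P.complex.X i ⟶ M} (h : toKX P f = toKX P g) : f = g := toK_inj M h

/-- morphism representing the class of a cocycle -/
noncomputable def kapOp {X : ModuleCat.{u} R} (P : ProjectiveResolution X)
    (f : P.complex.X i ⟶ M) (hf : P.complex.d (i+1) i ≫ f = 0) :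
    ((homOp M).leftDerived i).obj X ⟶ op (ModuleCat.of R R) :=
  (isoLD P).hom ≫ (KP M P).homologyι i ≫
    (KP M P).descOpcycles (toKX P f) (i+1) (by simp) (toKX_cocycle P f hf)

/-- class of a cocycle -/
noncomputable def kap {X : ModuleCat.{u} R} (P : ProjectiveResolution X)
    (f : P.complex.X i ⟶ M) (hf : P.complex.d (i+1) i ≫ f = 0) : OExt M i X :=
  (kapOp P f hf).unop.hom (1 : R)

lemma hom_R_ext {N : (ModuleCat.{u} R)ᵒᵖ} {a b : N ⟶ op (ModuleCat.of R R)}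
    (h : a.unop.hom (1 : R) = b.unop.hom (1 : R)) : a = b := by
  apply Quiver.Hom.unop_inj
  ext
  exact h

instance : Injective (op (ModuleCat.of R R)) := by
  have : Projective (ModuleCat.of R R) := inferInstance
  infer_instance

lemma kap_surj {X : ModuleCat.{u} R} (P : ProjectiveResolution X) (w : OExt M i X) :
    ∃ f hf, kap P f hf = w := by
  let w1 : ((homOp M).leftDerived i).obj X ⟶ op (ModuleCat.of R R) :=
    (ModuleCat.ofHom (LinearMap.toSpanSingleton R (OExt M i X) w)).op
  let w2 : (KP M P).homology i ⟶ op (ModuleCat.of R R) := (isoLD P).inv ≫ w1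
  let w3 := Injective.factorThru w2 ((KP M P).homologyι i)
  obtain ⟨f, hf⟩ := toKX_surj P ((KP M P).pOpcycles i ≫ w3)
  have hd : P.complex.d (i+1) i ≫ f = 0 := by
    apply toKX_inj P
    rw [← toKX_d, hf, HomologicalComplex.d_pOpcycles_assoc, Limits.zero_comp]
    exact (toK_zero M).symm
  refine ⟨f, hd, ?_⟩
  have h4 : (KP M P).descOpcycles (toKX P f) (i+1) (by simp) (toKX_cocycle P f hd) = w3 := by
    rw [← cancel_epi ((KP M P).pOpcycles i), HomologicalComplex.p_descOpcycles]
    exact hf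
  have : kapOp P f hd = w1 := by
    unfold kapOp
    rw [h4]
    have h5 : (KP M P).homologyι i ≫ w3 = w2 := Injective.comp_factorThru _ _
    rw [h5]
    exact Iso.hom_inv_id_assoc _ _
  unfold kap
  rw [this]
  exact one_smul R w

lemma kap_add {X : ModuleCat.{u} R} (P : ProjectiveResolution X)
    (f g : P.complex.X i ⟶ M) (hf hg hfg) :
    kap P (f + g) hfg = kap P f hf + kap P g hg := by
  have : kapOp P (f+g) hfg = kapOp P f hf + kapOp P g hg := by
    unfold kapOp
    rw [← Preadditive.comp_add, ← Preadditive.comp_add]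
    congr 2
    rw [← cancel_epi ((KP M P).pOpcycles i)]
    simp only [Preadditive.comp_add, HomologicalComplex.p_descOpcycles]
    exact toK_add M f g
  unfold kap
  rw [this]
  rfl

lemma kap_natural {X Y : ModuleCat.{u} R} (P : ProjectiveResolution X)
    (Q : ProjectiveResolution Y) (g : X ⟶ Y) (φ : ProjectiveResolution.Hom P Q g)
    (f : Q.complex.X i ⟶ M) (hf) (hf') :
    OExtMap M i g (kap Q f hf) = kap P (φ.hom.f i ≫ f) hf' := by
  have : ((homOp M).leftDerived i).map g ≫ kapOp Q f hf = kapOp P (φ.hom.f i ≫ f) hf' := by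
    unfold kapOp
    rw [reassoc_of% isoLD_nat P Q g φ]
    congr 1
    rw [HomologicalComplex.homologyι_naturality_assoc]
    congr 1
    rw [← cancel_epi ((KP M P).pOpcycles i)]
    rw [HomologicalComplex.p_opcyclesMap_assoc, HomologicalComplex.p_descOpcycles,
      HomologicalComplex.p_descOpcycles]
    exact toK_comp M _ _
  unfold kap
  rw [← this]
  rfl

lemma kap_eq_zero_imp {X : ModuleCat.{u} R} (P : ProjectiveResolution X)
    (f : P.complex.X i ⟶ M) (hf) (h : kap P f hf = 0) (j : ℕ)
    (hj : (ComplexShape.down ℕ).next i = j) :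
    ∃ g : P.complex.X j ⟶ M, P.complex.d i j ≫ g = f := by
  have h1 : kapOp P f hf = 0 := hom_R_ext h
  unfold kapOp at h1
  have h2 := (cancel_epi (isoLD P).hom).1 (h1.trans Limits.comp_zero.symm)
  let S : ShortComplex (ModuleCat.{u} R)ᵒᵖ :=
    ShortComplex.mk ((KP M P).homologyι i) ((KP M P).fromOpcycles i j) (by simp)
  have hS : S.Exact := S.exact_of_f_is_kernel ((KP M P).homologyIsKernel i j hj)
  obtain ⟨g, hg⟩ := toKX_surj P (hS.descToInjective _ h2)
  refine ⟨g, ?_⟩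
  apply toKX_inj P
  rw [← toKX_d, hg]
  have h3 := hS.comp_descToInjective _ h2
  have h4 := congrArg (fun k => (KP M P).pOpcycles i ≫ k) h3
  simp only [S, HomologicalComplex.p_fromOpcycles_assoc] at h4
  rw [h4, HomologicalComplex.p_descOpcycles]

lemma kap_d {X : ModuleCat.{u} R} (P : ProjectiveResolution X) (j : ℕ)
    (g : P.complex.X j ⟶ M) (hf) : kap (i := i) P (P.complex.d i j ≫ g) hf = 0 := by
  have : kapOp (i := i) P (P.complex.d i j ≫ g) hf = 0 := by
    unfold kapOp
    have : (KP M P).descOpcycles (toKX P (P.complex.d i j ≫ g)) (i+1) (by simp)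
        (toKX_cocycle P _ hf) = (KP M P).fromOpcycles i j ≫ toKX P g := by
      rw [← cancel_epi ((KP M P).pOpcycles i)]
      rw [HomologicalComplex.p_fromOpcycles_assoc, HomologicalComplex.p_descOpcycles]
      exact (toKX_d P _).symm
    rw [this]
    simp
  unfold kap
  rw [this]
  rfl

end oldExt
end LCFin

end part8

section part9

set_option linter.unusedSimpArgs false
set_option linter.unusedSectionVars false

namespace LCFin
section newExt
open Opposite
variable {R : Type u} [CommRing R] {M : ModuleCat.{u} R} {i : ℕ}

lemma kap_smul {X : ModuleCat.{u} R} (P : ProjectiveResolution X)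
    (r : R) (f : P.complex.X i ⟶ M) (hf hf') :
    kap P (r • f) hf' = r • kap P f hf := by
  let s : op (ModuleCat.of R R) ⟶ op (ModuleCat.of R R) :=
    (ModuleCat.ofHom (LinearMap.toSpanSingleton R R r)).op
  have h1 : toKX P (r • f) = toKX P f ≫ s := by
    apply hom_R_ext
    change (1 : R) • (r • f) = ((1 : R) • r) • f
    simp
  have : kapOp P (r • f) hf' = kapOp P f hf ≫ s := by
    unfold kapOp
    rw [Category.assoc, Category.assoc]
    congr 2
    rw [← cancel_epi ((KP M P).pOpcycles i)]
    rw [HomologicalComplex.p_descOpcycles_assoc, HomologicalComplex.p_descOpcycles, h1]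
  unfold kap
  rw [this]
  change (kapOp P f hf).unop.hom ((1 : R) • r) = _
  rw [one_smul, ← map_smul]
  congr 1
  simp

lemma extMk_eq_zero_iff_zero {X : ModuleCat.{u} R} (P : ProjectiveResolution X)
    (f : P.complex.X 0 ⟶ M) (hf : P.complex.d 1 0 ≫ f = 0) :
    P.extMk f 1 rfl hf = 0 ↔ f = 0 := by
  constructor
  · intro h
    simp only [← P.extEquivCohomologyClass.apply_eq_iff_eq,
      ProjectiveResolution.extEquivCohomologyClass_extMk,
      ProjectiveResolution.extEquivCohomologyClass_zero,
      CochainComplex.HomComplex.CohomologyClass.mk_eq_zero_iff] at h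
    rw [CochainComplex.HomComplex.Cocycle.toSingleMk_mem_coboundaries_iff _ _ _ _ _ 1
      (by simp)] at h
    obtain ⟨g, hg⟩ := h
    have hz : Limits.IsZero (P.cochainComplex.X 1) := P.cochainComplex.isZero_of_isStrictlyLE 0 1 (by norm_num)
    rw [hz.eq_of_src g 0, Limits.comp_zero] at hg
    rw [← cancel_epi (P.cochainComplexXIso (-(0:ℕ)) 0 rfl).hom, ← hg, Limits.comp_zero]
  · rintro rfl
    simp

lemma kap_eq_iff {X : ModuleCat.{u} R} (P : ProjectiveResolution X)
    (f g : P.complex.X i ⟶ M) (hf hg) :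
    kap P f hf = kap P g hg ↔ P.extMk f (i+1) rfl hf = P.extMk g (i+1) rfl hg := by
  have hfg : P.complex.d (i+1) i ≫ (f - g) = 0 := by simp [hf, hg]
  have h1 : kap P f hf = kap P (f - g) hfg + kap P g hg := by
    rw [← kap_add (hfg := by simp [hf])]
    congr 1
    simp
  rw [h1, add_eq_right, ← sub_eq_zero (b := P.extMk g (i+1) rfl hg), P.sub_extMk]
  rcases i with _ | i
  · rw [extMk_eq_zero_iff_zero]
    constructor
    · intro h
      obtain ⟨g', hg'⟩ := kap_eq_zero_imp P _ _ h 0 (by simp)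
      rw [← hg', P.complex.shape _ _ (by simp), Limits.zero_comp]
    · intro h
      have := kap_d (i := 0) P 0 (0 : P.complex.X 0 ⟶ M) (by simp)
      rw [← this]
      congr 1
  · rw [P.extMk_eq_zero_iff _ _ _ _ i rfl]
    constructor
    · intro h
      exact kap_eq_zero_imp P _ _ h i (by simp)
    · rintro ⟨g', hg'⟩
      have := kap_d (i := i+1) P i g' (by simp)
      rw [← this]
      congr 1
      exact hg'.symm

/-- chosen resolution -/
noncomputable abbrev pr (X : ModuleCat.{u} R) : ProjectiveResolution X := projectiveResolution X

/-- comparison -/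
noncomputable def toO (X : ModuleCat.{u} R) (α : Abelian.Ext X M i) : OExt M i X :=
  kap (pr X) ((pr X).extMk_surjective α (i+1) rfl).choose
    ((pr X).extMk_surjective α (i+1) rfl).choose_spec.choose

lemma toO_extMk (X : ModuleCat.{u} R) (f : (pr X).complex.X i ⟶ M) (hf) :
    toO X ((pr X).extMk f (i+1) rfl hf) = kap (pr X) f hf := by
  unfold toO
  rw [kap_eq_iff]
  exact ((pr X).extMk_surjective _ (i+1) rfl).choose_spec.choose_spec

lemma toO_surj (X : ModuleCat.{u} R) : Function.Surjective (toO (M := M) (i := i) X) := by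
  intro w
  obtain ⟨f, hf, rfl⟩ := kap_surj (pr X) w
  exact ⟨_, toO_extMk X f hf⟩

lemma toO_inj (X : ModuleCat.{u} R) : Function.Injective (toO (M := M) (i := i) X) := by
  intro α β h
  obtain ⟨f, hf, rfl⟩ := (pr X).extMk_surjective α (i+1) rfl
  obtain ⟨g, hg, rfl⟩ := (pr X).extMk_surjective β (i+1) rfl
  rwa [toO_extMk, toO_extMk, kap_eq_iff] at h

lemma toO_add (X : ModuleCat.{u} R) (α β : Abelian.Ext X M i) :
    toO X (α + β) = toO X α + toO X β := by
  obtain ⟨f, hf, rfl⟩ := (pr X).extMk_surjective α (i+1) rfl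
  obtain ⟨g, hg, rfl⟩ := (pr X).extMk_surjective β (i+1) rfl
  rw [ProjectiveResolution.add_extMk, toO_extMk, toO_extMk, toO_extMk, kap_add]

lemma toO_zero (X : ModuleCat.{u} R) : toO X (0 : Abelian.Ext X M i) = 0 := by
  have := toO_add X (0 : Abelian.Ext X M i) 0
  simpa using this

lemma toO_natural {X Y : ModuleCat.{u} R} (g : X ⟶ Y) (α : Abelian.Ext Y M i) :
    toO X ((Abelian.Ext.mk₀ g).comp α (zero_add i)) = OExtMap M i g (toO Y α) := by
  obtain ⟨f, hf, rfl⟩ := (pr Y).extMk_surjective α (i+1) rfl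
  let φ : ProjectiveResolution.Hom (pr X) (pr Y) g :=
    ⟨ProjectiveResolution.lift g (pr X) (pr Y),
      by simpa using ProjectiveResolution.lift_commutes_zero g (pr X) (pr Y)⟩
  rw [ProjectiveResolution.mk₀_comp_extMk _ _ _ _ φ, toO_extMk, toO_extMk,
    kap_natural (φ := φ)]

lemma OExtMap_smul {X : ModuleCat.{u} R} (r : R) (w : OExt M i X) :
    OExtMap M i (r • 𝟙 X) w = r • w := by
  obtain ⟨f, hf, rfl⟩ := kap_surj (pr X) w
  let φ : ProjectiveResolution.Hom (pr X) (pr X) (r • 𝟙 X) := ⟨r • 𝟙 _, by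
    change (r • 𝟙 _) ≫ (pr X).π.f 0 = (pr X).π.f 0 ≫ (r • 𝟙 X)
    have h (Y : ModuleCat.{u} R) (q : Y ⟶ X) : (r • 𝟙 _) ≫ q = q ≫ (r • 𝟙 X) := by simp
    exact h _ _⟩
  have h : φ.hom.f i ≫ f = r • f := by simp [φ]
  rw [kap_natural (φ := φ) (hf' := by rw [h]; simp [hf])]
  rw [← kap_smul (hf' := by simp [hf])]
  congr 1

/-- `Ext^i(-,M)` is presented as `Hom(-,N)` modulo maps factoring through `p`. -/
def IsW (M : ModuleCat.{u} R) (i : ℕ) {E N : ModuleCat.{u} R} (p : E ⟶ N) : Prop :=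
  ∃ ω : Abelian.Ext N M i, ∀ X : ModuleCat.{u} R,
    (∀ α : Abelian.Ext X M i, ∃ g : X ⟶ N, (Abelian.Ext.mk₀ g).comp ω (zero_add i) = α) ∧
    (∀ g : X ⟶ N, (Abelian.Ext.mk₀ g).comp ω (zero_add i) = 0 ↔ ∃ h : X ⟶ E, h ≫ p = g)

lemma isW_zero (M E : ModuleCat.{u} R) : IsW M 0 (0 : E ⟶ M) := by
  refine ⟨Abelian.Ext.mk₀ (𝟙 M), fun X => ⟨fun α => ?_, fun g => ?_⟩⟩
  · obtain ⟨g, rfl⟩ := (Abelian.Ext.mk₀_bijective X M).2 α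
    exact ⟨g, by simp⟩
  · simp only [Abelian.Ext.comp_mk₀_id, Abelian.Ext.mk₀_eq_zero_iff, Limits.comp_zero]
    exact ⟨fun h => ⟨0, h.symm⟩, fun ⟨_, h⟩ => h.symm⟩

lemma isW_one {S : ShortComplex (ModuleCat.{u} R)} (hS : S.ShortExact) [Injective S.X₂] :
    IsW S.X₁ 1 S.g := by
  refine ⟨hS.extClass, fun X => ⟨fun α => ?_, fun g => ?_⟩⟩
  · obtain ⟨x, hx⟩ := Abelian.Ext.covariant_sequence_exact₁ X hS α
      (Abelian.Ext.eq_zero_of_injective _) (zero_add 1)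
    obtain ⟨g, rfl⟩ := (Abelian.Ext.mk₀_bijective X _).2 x
    exact ⟨g, hx⟩
  · constructor
    · intro h
      obtain ⟨x, hx⟩ := Abelian.Ext.covariant_sequence_exact₃ X hS (Abelian.Ext.mk₀ g) (zero_add 1) h
      obtain ⟨h, rfl⟩ := (Abelian.Ext.mk₀_bijective X _).2 x
      refine ⟨h, ?_⟩
      rw [Abelian.Ext.mk₀_comp_mk₀] at hx
      exact (Abelian.Ext.mk₀_bijective X _).1 hx
    · rintro ⟨h, rfl⟩
      rw [← Abelian.Ext.mk₀_comp_mk₀_assoc]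
      simp

lemma isW_succ {S : ShortComplex (ModuleCat.{u} R)} (hS : S.ShortExact) [Injective S.X₂]
    {E N : ModuleCat.{u} R} (p : E ⟶ N) (h : IsW S.X₃ (i+1) p) : IsW S.X₁ (i+2) p := by
  obtain ⟨ω, hω⟩ := h
  refine ⟨ω.comp hS.extClass rfl, fun X => ⟨fun α => ?_, fun g => ?_⟩⟩
  · obtain ⟨x, hx⟩ := Abelian.Ext.covariant_sequence_exact₁ X hS α
      (Abelian.Ext.eq_zero_of_injective _) (n₀ := i+1) rfl
    obtain ⟨g, hg⟩ := (hω X).1 x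
    refine ⟨g, ?_⟩
    rw [← hx, ← hg]
    exact (Abelian.Ext.comp_assoc _ _ _ _ _ (by simp)).symm
  · rw [← (hω X).2 g, ← Abelian.Ext.comp_assoc _ _ _ (zero_add (i+1)) _ (by omega)]
    constructor
    · intro h
      obtain ⟨x, hx⟩ := Abelian.Ext.covariant_sequence_exact₃ X hS _ _ h
      rw [← hx, Abelian.Ext.eq_zero_of_injective x]
      simp
    · intro h
      rw [h]; simp

lemma IsW.theta {E N : ModuleCat.{u} R} {p : E ⟶ N} (h : IsW M i p) :
    ∃ θ : ∀ X : ModuleCat.{u} R, (X ⟶ N) →ₗ[R] OExt M i X,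
      (∀ X, Function.Surjective (θ X)) ∧
      (∀ X (g : X ⟶ N), θ X g = 0 ↔ ∃ h : X ⟶ E, h ≫ p = g) ∧
      (∀ X Y (f : X ⟶ Y) (g : Y ⟶ N), OExtMap M i f (θ Y g) = θ X (f ≫ g)) := by
  obtain ⟨ω, hω⟩ := h
  have hnat : ∀ X Y (f : X ⟶ Y) (g : Y ⟶ N),
      OExtMap M i f (toO Y ((Abelian.Ext.mk₀ g).comp ω (zero_add i))) =
        toO X ((Abelian.Ext.mk₀ (f ≫ g)).comp ω (zero_add i)) := by
    intro X Y f g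
    rw [← toO_natural, Abelian.Ext.mk₀_comp_mk₀_assoc]
  refine ⟨fun X =>
    { toFun := fun g => toO X ((Abelian.Ext.mk₀ g).comp ω (zero_add i))
      map_add' := fun g g' => ?_
      map_smul' := fun r g => ?_ }, fun X w => ?_, fun X g => ?_, hnat⟩
  · rw [Abelian.Ext.mk₀_add, Abelian.Ext.add_comp, toO_add]
  · rw [RingHom.id_apply, ← OExtMap_smul, hnat]
    simp
  · obtain ⟨α, rfl⟩ := toO_surj X w
    obtain ⟨g, rfl⟩ := (hω X).1 α
    exact ⟨g, rfl⟩
  · rw [← (hω X).2 g]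
    change toO X _ = 0 ↔ _
    rw [← toO_zero X]
    exact (toO_inj X).eq_iff

end newExt
end LCFin

end part9

section part10

set_option linter.unusedSimpArgs false
set_option linter.unusedSectionVars false

namespace LCFin
section lc
open Opposite
variable {R : Type u} [CommRing R]

/-- `I`-power torsion. -/
def Gam (I : Ideal R) (N : Type u) [AddCommGroup N] [Module R N] : Submodule R N where
  carrier := {y | ∃ t : ℕ, ∀ a ∈ I ^ t, a • y = 0}
  zero_mem' := ⟨0, by simp⟩
  add_mem' := by
    rintro x y ⟨s, hs⟩ ⟨t, ht⟩
    refine ⟨s + t, fun a ha => ?_⟩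
    rw [smul_add, hs a (Ideal.pow_le_pow_right (by omega) ha),
      ht a (Ideal.pow_le_pow_right (by omega) ha), add_zero]
  smul_mem' := by
    rintro r y ⟨t, ht⟩
    exact ⟨t, fun a ha => by rw [smul_comm, ht a ha, smul_zero]⟩

lemma Gam_map (I : Ideal R) {N N' : Type u} [AddCommGroup N] [Module R N]
    [AddCommGroup N'] [Module R N'] (p : N →ₗ[R] N') {y : N} (hy : y ∈ Gam I N) :
    p y ∈ Gam I N' := by
  obtain ⟨t, ht⟩ := hy
  exact ⟨t, fun a ha => by rw [← map_smul, ht a ha, map_zero]⟩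

/-- the map `R/I^t → N` given by an element killed by `I^t`. -/
def homOf (I : Ideal R) {N : ModuleCat.{u} R} (t : ℕ) (y : N) (hy : ∀ a ∈ I ^ t, a • y = 0) :
    ModuleCat.of R (R ⧸ I ^ t) ⟶ N :=
  ModuleCat.ofHom ((I ^ t).liftQ (LinearMap.toSpanSingleton R N y) (fun a ha => hy a ha))

lemma homOf_ext (I : Ideal R) {N : ModuleCat.{u} R} (t : ℕ)
    {f g : ModuleCat.of R (R ⧸ I ^ t) ⟶ N}
    (h : f.hom (Submodule.Quotient.mk (p := I ^ t) 1) =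
      g.hom (Submodule.Quotient.mk (p := I ^ t) 1)) : f = g := by
  apply ModuleCat.hom_ext
  apply Submodule.linearMap_qext
  ext
  exact h

lemma homOf_apply (I : Ideal R) {N : ModuleCat.{u} R} (t : ℕ) (y : N) (hy) :
    (homOf I t y hy).hom (Submodule.Quotient.mk (p := I ^ t) 1) = y := by
  change (1 : R) • y = y
  simp

lemma homOf_kill (I : Ideal R) {N : ModuleCat.{u} R} (t : ℕ)
    (f : ModuleCat.of R (R ⧸ I ^ t) ⟶ N) :
    ∀ a ∈ I ^ t, a • f.hom (Submodule.Quotient.mk (p := I ^ t) 1) = 0 := by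
  intro a ha
  rw [← map_smul, ← Submodule.Quotient.mk_smul, smul_eq_mul, mul_one,
    (Submodule.Quotient.mk_eq_zero _).2 ha, map_zero]

/-- structure maps of the colimit -/
noncomputable def cmapLC (I : Ideal R) (M : ModuleCat.{u} R) (i t : ℕ) :
    OExt M i (ModuleCat.of R (R ⧸ I ^ t)) →ₗ[R] ((localCohomology I i).obj M) :=
  ((Limits.colimit.ι (localCohomology.diagram (localCohomology.idealPowersDiagram I) i)
    (op (op t))).app M).hom

/-- transition -/
noncomputable def trans (I : Ideal R) {s t : ℕ} (h : s ≤ t) :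
    ModuleCat.of R (R ⧸ I ^ t) ⟶ ModuleCat.of R (R ⧸ I ^ s) :=
  (localCohomology.ringModIdeals (localCohomology.idealPowersDiagram I)).map (homOfLE h).op

lemma trans_one (I : Ideal R) {s t : ℕ} (h : s ≤ t) :
    (trans I h).hom (Submodule.Quotient.mk (p := I ^ t) 1) =
      Submodule.Quotient.mk (p := I ^ s) 1 := rfl

lemma cmapLC_trans (I : Ideal R) (M : ModuleCat.{u} R) (i : ℕ) {s t : ℕ} (h : s ≤ t)
    (w : OExt M i (ModuleCat.of R (R ⧸ I ^ s))) :
    cmapLC I M i t (OExtMap M i (trans I h) w) = cmapLC I M i s w := by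
  have := Limits.colimit.w (localCohomology.diagram (localCohomology.idealPowersDiagram I) i)
    (homOfLE h).op.op
  have h2 := congrArg (fun k => (k.app M).hom w) this
  exact h2

lemma cmapLC_isColimit (I : Ideal R) (M : ModuleCat.{u} R) (i : ℕ) :
    Nonempty (Limits.IsColimit (((evaluation (ModuleCat.{u} R) (ModuleCat.{u} R)).obj M).mapCocone
      (Limits.colimit.cocone
        (localCohomology.diagram (localCohomology.idealPowersDiagram I) i)))) :=
  ⟨Limits.isColimitOfPreserves _ (Limits.colimit.isColimit _)⟩

instance forgetPres :
    Limits.PreservesFilteredColimitsOfSize.{0, 0} (forget (ModuleCat.{u} R)) :=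
  Limits.preservesFilteredColimitsOfSize_shrink.{0, u, 0, u} _

lemma cmapLC_surj (I : Ideal R) (M : ModuleCat.{u} R) (i : ℕ)
    (w : (localCohomology I i).obj M) : ∃ t v, cmapLC I M i t v = w := by
  obtain ⟨hc⟩ := cmapLC_isColimit I M i
  obtain ⟨j, v, hv⟩ := Limits.Concrete.isColimit_exists_rep _ hc w
  exact ⟨j.unop.unop, v, hv⟩

lemma cmapLC_zero (I : Ideal R) (M : ModuleCat.{u} R) (i s : ℕ)
    (v) (h : cmapLC I M i s v = 0) : ∃ t, ∃ (h : s ≤ t), OExtMap M i (trans I h) v = 0 := by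
  obtain ⟨hc⟩ := cmapLC_isColimit I M i
  obtain ⟨k, f, g, hfg⟩ := Limits.Concrete.isColimit_exists_of_rep_eq _ hc
    (i := op (op s)) (j := op (op s)) v 0 (h.trans (map_zero (cmapLC I M i s)).symm)
  refine ⟨k.unop.unop, leOfHom f.unop.unop, ?_⟩
  exact hfg.trans (map_zero _)

theorem lc_desc (I : Ideal R) (M : ModuleCat.{u} R) (i : ℕ) {E N : ModuleCat.{u} R} {p : E ⟶ N}
    (h : IsW M i p) :
    ∃ Φ : Gam I N →ₗ[R] ((localCohomology I i).obj M), Function.Surjective Φ ∧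
      ∀ y, Φ y = 0 ↔ ∃ e ∈ Gam I E, p.hom e = y := by
  obtain ⟨θ, hs, hz, hn⟩ := h.theta
  have htr : ∀ {s t : ℕ} (hst : s ≤ t) (y : N) (hy hy'),
      cmapLC I M i t (θ _ (homOf I t y hy)) = cmapLC I M i s (θ _ (homOf I s y hy')) := by
    intro s t hst y hy hy'
    rw [← cmapLC_trans I M i hst, hn]
    congr 2
    apply homOf_ext
    rw [homOf_apply]
    exact (homOf_apply I s y hy').symm
  have htr2 : ∀ {s t : ℕ} (y : N) (hy hy'),
      cmapLC I M i t (θ _ (homOf I t y hy)) = cmapLC I M i s (θ _ (homOf I s y hy')) := by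
    intro s t y hy hy'
    rcases le_total s t with h | h
    · exact htr h y hy hy'
    · exact (htr h y hy' hy).symm
  let φ : Gam I N → ((localCohomology I i).obj M) := fun y =>
    cmapLC I M i y.2.choose (θ _ (homOf I y.2.choose y.1 y.2.choose_spec))
  have hφ : ∀ (y : Gam I N) (t : ℕ) (ht), φ y = cmapLC I M i t (θ _ (homOf I t y.1 ht)) :=
    fun y t ht => htr2 _ _ _
  refine ⟨{ toFun := φ, map_add' := ?_, map_smul' := ?_ }, ?_, ?_⟩
  · intro x y
    obtain ⟨s, hs⟩ := x.2
    obtain ⟨t, ht⟩ := y.2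
    have h1 : ∀ a ∈ I ^ (s + t), a • x.1 = 0 :=
      fun a ha => hs a (Ideal.pow_le_pow_right (by omega) ha)
    have h2 : ∀ a ∈ I ^ (s + t), a • y.1 = 0 :=
      fun a ha => ht a (Ideal.pow_le_pow_right (by omega) ha)
    have h3 : ∀ a ∈ I ^ (s + t), a • (x + y).1 = 0 := fun a ha => by
      change a • (x.1 + y.1) = 0
      rw [smul_add, h1 a ha, h2 a ha, add_zero]
    rw [hφ _ _ h1, hφ _ _ h2, hφ _ _ h3, ← map_add, ← map_add]
    congr 2
    apply homOf_ext
    rw [homOf_apply]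
    change _ = (homOf I _ x.1 h1).hom _ + (homOf I _ y.1 h2).hom _
    rw [homOf_apply, homOf_apply]
    rfl
  · intro r x
    obtain ⟨s, hs⟩ := x.2
    have h3 : ∀ a ∈ I ^ s, a • (r • x).1 = 0 := fun a ha => by
      change a • (r • x.1) = 0
      rw [smul_comm, hs a ha, smul_zero]
    rw [RingHom.id_apply, hφ _ _ hs, hφ _ _ h3, ← map_smul, ← map_smul]
    congr 2
    apply homOf_ext
    rw [homOf_apply]
    change _ = r • (homOf I _ x.1 hs).hom _
    rw [homOf_apply]
    rfl
  · intro w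
    obtain ⟨t, v, rfl⟩ := cmapLC_surj I M i w
    obtain ⟨g, rfl⟩ := hs _ v
    refine ⟨⟨g.hom (Submodule.Quotient.mk (p := I ^ t) 1), t, homOf_kill I t g⟩, ?_⟩
    change φ _ = _
    rw [hφ _ t (homOf_kill I t g)]
    congr 2
    apply homOf_ext
    rw [homOf_apply]
  · intro y
    change φ y = 0 ↔ _
    constructor
    · intro h0
      obtain ⟨s, hs⟩ := y.2
      rw [hφ y s hs] at h0
      obtain ⟨t, hst, ht⟩ := cmapLC_zero I M i s _ h0
      rw [hn, hz] at ht
      obtain ⟨h, hh⟩ := ht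
      refine ⟨h.hom (Submodule.Quotient.mk (p := I ^ t) 1), ⟨t, homOf_kill I t h⟩, ?_⟩
      have h5 := congrArg (fun k => k.hom (Submodule.Quotient.mk (p := I ^ t) 1)) hh
      refine h5.trans ?_
      exact homOf_apply I s y.1 hs
    · rintro ⟨e, ⟨t, ht⟩, he⟩
      have h1 : ∀ a ∈ I ^ t, a • y.1 = 0 := fun a ha => by
        rw [← he, ← map_smul, ht a ha, map_zero]
      rw [hφ y t h1]
      have : θ _ (homOf I t y.1 h1) = 0 := by
        rw [hz]
        refine ⟨homOf I t e ht, ?_⟩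
        apply homOf_ext
        rw [homOf_apply, ← he]
        exact congrArg p.hom (homOf_apply I t e ht)
      rw [this, map_zero]

end lc
end LCFin

end part10

section part11

set_option linter.unusedSimpArgs false
set_option linter.unusedSectionVars false

namespace LCFin
section cech
variable {R : Type u} [CommRing R]

/-- localization at one element -/
abbrev Mf (f : R) (M : ModuleCat.{u} R) : ModuleCat.{u} R :=
  ModuleCat.of R (LocalizedModule (Submonoid.powers f) M)

/-- localization map -/
noncomputable abbrev mkf (f : R) (M : ModuleCat.{u} R) : M →ₗ[R] Mf f M :=
  LocalizedModule.mkLinearMap (Submonoid.powers f) M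

/-- functoriality of localization -/
noncomputable def mapf (f : R) {M N : ModuleCat.{u} R} (g : M →ₗ[R] N) : Mf f M →ₗ[R] Mf f N :=
  IsLocalizedModule.map (Submonoid.powers f) (mkf f M) (mkf f N) g

lemma mapf_mk (f : R) {M N : ModuleCat.{u} R} (g : M →ₗ[R] N) (m : M) :
    mapf f g (mkf f M m) = mkf f N (g m) :=
  IsLocalizedModule.map_apply _ _ _ _ _

lemma mapf_comp (f : R) {M N L : ModuleCat.{u} R} (g : M →ₗ[R] N) (h : N →ₗ[R] L) :
    mapf f (h ∘ₗ g) = mapf f h ∘ₗ mapf f g := by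
  apply IsLocalizedModule.ext (Submonoid.powers f) (mkf f M)
  · exact IsLocalizedModule.map_units (mkf f L)
  · refine LinearMap.ext fun m => ?_
    change mapf f (h ∘ₗ g) (mkf f M m) = mapf f h (mapf f g (mkf f M m))
    rw [mapf_mk, mapf_mk, mapf_mk]
    rfl

/-- Cech cochains -/
noncomputable def cX : List R → ModuleCat.{u} R → ℕ → ModuleCat.{u} R
  | [], M, 0 => M
  | [], _, _ + 1 => ModuleCat.of R PUnit.{u+1}
  | _ :: fs, M, 0 => cX fs M 0
  | f :: fs, M, i + 1 => ModuleCat.of R (cX fs M (i + 1) × cX fs (Mf f M) i)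

/-- functoriality of Cech cochains -/
noncomputable def cmap : ∀ (fs : List R) {M N : ModuleCat.{u} R} (_ : M →ₗ[R] N) (i : ℕ),
    cX fs M i →ₗ[R] cX fs N i
  | [], _, _, g, 0 => g
  | [], _, _, _, _ + 1 => 0
  | _ :: fs, _, _, g, 0 => cmap fs g 0
  | f :: fs, _, _, g, i + 1 => LinearMap.prodMap (cmap fs g (i + 1)) (cmap fs (mapf f g) i)

/-- Cech differential -/
noncomputable def cd : ∀ (fs : List R) (M : ModuleCat.{u} R) (i : ℕ),
    cX fs M i →ₗ[R] cX fs M (i + 1)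
  | [], _, _ => 0
  | f :: fs, M, 0 => LinearMap.prod (cd fs M 0) (cmap fs (mkf f M) 0)
  | f :: fs, M, i + 1 => LinearMap.prod (cd fs M (i + 1) ∘ₗ LinearMap.fst R _ _)
      (cmap fs (mkf f M) (i + 1) ∘ₗ LinearMap.fst R _ _ - cd fs (Mf f M) i ∘ₗ LinearMap.snd R _ _)

/-- degree zero -/
noncomputable def aug : ∀ (fs : List R) (M : ModuleCat.{u} R), M ≃ₗ[R] cX fs M 0
  | [], M => LinearEquiv.refl R M
  | _ :: fs, M => aug fs M

lemma cd_zero_apply (f : R) (fs : List R) (M : ModuleCat.{u} R) (a : cX fs M 0) :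
    cd (f :: fs) M 0 a = (cd fs M 0 a, cmap fs (mkf f M) 0 a) := rfl

lemma cd_succ_apply (f : R) (fs : List R) (M : ModuleCat.{u} R) (i : ℕ) (a : cX fs M (i + 1))
    (b : cX fs (Mf f M) i) :
    cd (f :: fs) M (i + 1) (a, b) =
      (cd fs M (i + 1) a, cmap fs (mkf f M) (i + 1) a - cd fs (Mf f M) i b) := rfl

lemma cmap_succ_apply (f : R) (fs : List R) {M N : ModuleCat.{u} R} (g : M →ₗ[R] N) (i : ℕ)
    (a : cX fs M (i + 1)) (b : cX fs (Mf f M) i) :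
    cmap (f :: fs) g (i + 1) (a, b) = (cmap fs g (i + 1) a, cmap fs (mapf f g) i b) := rfl

lemma cmap_comp (fs : List R) : ∀ {M N L : ModuleCat.{u} R} (g : M →ₗ[R] N) (h : N →ₗ[R] L)
    (i : ℕ) (a : cX fs M i), cmap fs (h ∘ₗ g) i a = cmap fs h i (cmap fs g i a) := by
  induction fs with
  | nil =>
    intro M N L g h i a
    cases i <;> rfl
  | cons f fs ih =>
    intro M N L g h i a
    cases i with
    | zero => exact ih g h 0 a
    | succ i =>
      obtain ⟨a, b⟩ := a
      rw [cmap_succ_apply, cmap_succ_apply]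
      erw [cmap_succ_apply]
      rw [ih, mapf_comp, ih]

lemma cmap_aug (fs : List R) : ∀ {M N : ModuleCat.{u} R} (g : M →ₗ[R] N) (m : M),
    cmap fs g 0 (aug fs M m) = aug fs N (g m) := by
  induction fs with
  | nil => intro M N g m; rfl
  | cons f fs ih => intro M N g m; exact ih g m

lemma cmap_mk_nat (f : R) (fs : List R) {M N : ModuleCat.{u} R} (g : M →ₗ[R] N) (i : ℕ)
    (a : cX fs M i) :
    cmap fs (mapf f g) i (cmap fs (mkf f M) i a) = cmap fs (mkf f N) i (cmap fs g i a) := by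
  rw [← cmap_comp, ← cmap_comp]
  congr 1
  congr 1
  ext m
  exact mapf_mk f g m

lemma cmap_cd (fs : List R) : ∀ {M N : ModuleCat.{u} R} (g : M →ₗ[R] N) (i : ℕ) (a : cX fs M i),
    cmap fs g (i + 1) (cd fs M i a) = cd fs N i (cmap fs g i a) := by
  induction fs with
  | nil => intro M N g i a; rfl
  | cons f fs ih =>
    intro M N g i a
    cases i with
    | zero =>
      exact Prod.ext (ih g 0 a) (cmap_mk_nat f fs g 0 a)
    | succ i =>
      obtain ⟨a, b⟩ := a
      rw [cmap_succ_apply, cd_succ_apply]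
      erw [cmap_succ_apply, cd_succ_apply]
      rw [ih, map_sub, ih, cmap_mk_nat]

lemma cd_cd (fs : List R) : ∀ (M : ModuleCat.{u} R) (i : ℕ) (a : cX fs M i),
    cd fs M (i + 1) (cd fs M i a) = 0 := by
  induction fs with
  | nil => intro M i a; rfl
  | cons f fs ih =>
    intro M i a
    cases i with
    | zero =>
      exact Prod.ext (ih M 0 a) (sub_eq_zero.2 (cmap_cd fs (mkf f M) 0 a))
    | succ i =>
      obtain ⟨a, b⟩ := a
      rw [cd_succ_apply]
      erw [cd_succ_apply]
      rw [ih, map_sub, ih, cmap_cd, sub_zero, sub_self]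
      rfl

lemma mapf_inj (f : R) {M N : ModuleCat.{u} R} (g : M →ₗ[R] N) (hg : Function.Injective g) :
    Function.Injective (mapf f g) :=
  IsLocalizedModule.map_injective _ _ _ g hg

lemma mapf_surj (f : R) {M N : ModuleCat.{u} R} (g : M →ₗ[R] N) (hg : Function.Surjective g) :
    Function.Surjective (mapf f g) :=
  IsLocalizedModule.map_surjective _ _ _ g hg

lemma mapf_exact (f : R) {M N L : ModuleCat.{u} R} (g : M →ₗ[R] N) (h : N →ₗ[R] L)
    (hgh : Function.Exact g h) : Function.Exact (mapf f g) (mapf f h) :=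
  IsLocalizedModule.map_exact _ (mkf f M) (mkf f N) (mkf f L) g h hgh

lemma cmap_inj (fs : List R) : ∀ {M N : ModuleCat.{u} R} (g : M →ₗ[R] N)
    (_ : Function.Injective g) (i : ℕ), Function.Injective (cmap fs g i) := by
  induction fs with
  | nil =>
    intro M N g hg i
    cases i with
    | zero => exact hg
    | succ i => intro a b _; rfl
  | cons f fs ih =>
    intro M N g hg i
    cases i with
    | zero => exact ih g hg 0
    | succ i => exact Function.Injective.prodMap (ih g hg _) (ih _ (mapf_inj f g hg) _)

lemma cmap_surj (fs : List R) : ∀ {M N : ModuleCat.{u} R} (g : M →ₗ[R] N)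
    (_ : Function.Surjective g) (i : ℕ), Function.Surjective (cmap fs g i) := by
  induction fs with
  | nil =>
    intro M N g hg i
    cases i with
    | zero => exact hg
    | succ i => intro a; exact ⟨0, rfl⟩
  | cons f fs ih =>
    intro M N g hg i
    cases i with
    | zero => exact ih g hg 0
    | succ i => exact Function.Surjective.prodMap (ih g hg _) (ih _ (mapf_surj f g hg) _)

lemma cmap_exact (fs : List R) : ∀ {M N L : ModuleCat.{u} R} (g : M →ₗ[R] N) (h : N →ₗ[R] L)
    (_ : Function.Exact g h) (i : ℕ), Function.Exact (cmap fs g i) (cmap fs h i) := by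
  induction fs with
  | nil =>
    intro M N L g h hgh i
    cases i with
    | zero => exact hgh
    | succ i => intro a; exact ⟨fun _ => ⟨0, rfl⟩, fun _ => rfl⟩
  | cons f fs ih =>
    intro M N L g h hgh i
    cases i with
    | zero => exact ih g h hgh 0
    | succ i =>
      rintro ⟨a, b⟩
      have h1 := ih g h hgh (i + 1) a
      have h2 := ih _ _ (mapf_exact f g h hgh) i b
      rw [cmap_succ_apply]
      constructor
      · intro h0
        obtain ⟨a', ha⟩ := h1.1 (congrArg Prod.fst h0)
        obtain ⟨b', hb⟩ := h2.1 (congrArg Prod.snd h0)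
        exact ⟨(a', b'), Prod.ext ha hb⟩
      · rintro ⟨⟨a', b'⟩, hab⟩
        exact Prod.ext (h1.2 ⟨a', congrArg Prod.fst hab⟩) (h2.2 ⟨b', congrArg Prod.snd hab⟩)

lemma mkf_eq_zero (f : R) (M : ModuleCat.{u} R) (y : M) :
    mkf f M y = 0 ↔ ∃ t : ℕ, f ^ t • y = 0 := by
  rw [IsLocalizedModule.eq_zero_iff (Submonoid.powers f)]
  constructor
  · rintro ⟨⟨_, t, rfl⟩, ht⟩
    exact ⟨t, ht⟩
  · rintro ⟨t, ht⟩
    exact ⟨⟨f ^ t, t, rfl⟩, ht⟩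

lemma cd_aug_eq_zero (fs : List R) : ∀ (M : ModuleCat.{u} R) (y : M),
    cd fs M 0 (aug fs M y) = 0 ↔ ∀ f ∈ fs, ∃ t : ℕ, f ^ t • y = 0 := by
  induction fs with
  | nil => intro M y; exact ⟨fun _ f hf => absurd hf List.not_mem_nil, fun _ => rfl⟩
  | cons f fs ih =>
    intro M y
    change (cd fs M 0 (aug fs M y), cmap fs (mkf f M) 0 (aug fs M y)) = (0, 0) ↔ _
    rw [Prod.mk.injEq, ih, cmap_aug, LinearEquiv.map_eq_zero_iff, mkf_eq_zero]
    rw [List.forall_mem_cons, and_comm]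

end cech
end LCFin

end part11

section part12

set_option linter.unusedSimpArgs false
set_option linter.unusedSectionVars false

namespace LCFin
section cechN
variable {R : Type u} [CommRing R] [IsNoetherianRing R]

lemma mem_Gam_iff (fs : List R) (M : ModuleCat.{u} R) (y : M) :
    y ∈ Gam (Ideal.span {f | f ∈ fs}) M ↔ ∀ f ∈ fs, ∃ t : ℕ, f ^ t • y = 0 := by
  constructor
  · rintro ⟨t, ht⟩ f hf
    exact ⟨t, ht _ (Ideal.pow_mem_pow (Ideal.subset_span (s := {f | f ∈ fs}) hf) t)⟩
  · intro h
    have h1 : Ideal.span {f | f ∈ fs} ≤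
        Ideal.radical (LinearMap.ker (LinearMap.toSpanSingleton R M y)) := by
      rw [Ideal.span_le]
      intro f hf
      obtain ⟨t, ht⟩ := h f hf
      exact ⟨t, ht⟩
    obtain ⟨t, ht⟩ := Ideal.exists_pow_le_of_le_radical_of_fg h1 (IsNoetherian.noetherian _)
    exact ⟨t, fun a ha => ht ha⟩

lemma cd_aug_Gam (fs : List R) (M : ModuleCat.{u} R) (y : M) :
    cd fs M 0 (aug fs M y) = 0 ↔ y ∈ Gam (Ideal.span {f | f ∈ fs}) M := by
  rw [cd_aug_eq_zero, mem_Gam_iff]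

lemma pow_smul_inj (f : R) (M : ModuleCat.{u} R) (t : ℕ) (x y : Mf f M)
    (h : f ^ t • x = f ^ t • y) : x = y :=
  ((Module.End.isUnit_iff _).1
    (IsLocalizedModule.map_units (mkf f M) (⟨f ^ t, t, rfl⟩ : Submonoid.powers f))).1 h

lemma pow_smul_surj (f : R) (M : ModuleCat.{u} R) (t : ℕ) (x : Mf f M) :
    ∃ y : Mf f M, f ^ t • y = x :=
  ((Module.End.isUnit_iff _).1
    (IsLocalizedModule.map_units (mkf f M) (⟨f ^ t, t, rfl⟩ : Submonoid.powers f))).2 x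

lemma exists_num (f : R) (M : ModuleCat.{u} R) (y : Mf f M) :
    ∃ (t : ℕ) (x : M), f ^ t • y = mkf f M x := by
  obtain ⟨⟨x, ⟨_, t, rfl⟩⟩, h⟩ := IsLocalizedModule.surj (Submonoid.powers f) (mkf f M) y
  exact ⟨t, x, h⟩

lemma inj_Mf (f : R) (E : ModuleCat.{u} R) (hE : Module.Injective R E) :
    Module.Injective R (Mf f E) := by
  apply Module.Baer.injective
  intro J h
  have : Module.FinitePresentation R J := Module.finitePresentation_of_finite R J
  obtain ⟨g, ⟨_, t, rfl⟩, hg⟩ :=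
    Module.FinitePresentation.exists_lift_of_isLocalizedModule (Submonoid.powers f) (mkf f E) h
  obtain ⟨g', hg'⟩ := Module.Baer.of_injective hE J g
  obtain ⟨w, hw⟩ := pow_smul_surj f E t (mkf f E (g' 1))
  refine ⟨LinearMap.toSpanSingleton R _ w, fun x hx => ?_⟩
  apply pow_smul_inj f E t
  have h1 := LinearMap.congr_fun hg ⟨x, hx⟩
  have h2 : mkf f E (g ⟨x, hx⟩) = f ^ t • h ⟨x, hx⟩ := h1
  rw [← h2, ← hg' x hx, LinearMap.toSpanSingleton_apply, smul_comm, hw, ← map_smul, ← map_smul,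
    smul_eq_mul, mul_one]

lemma inj_lift (f : R) (E : ModuleCat.{u} R) (hE : Module.Injective R E) (L : Ideal R)
    (y : Mf f E) (hy : ∀ a ∈ L, a • y = 0) :
    ∃ x : E, mkf f E x = y ∧ ∀ a ∈ L, a • x = 0 := by
  obtain ⟨t, x0, h0⟩ := exists_num f E y
  let J : ℕ →o Ideal R :=
    { toFun := fun k => LinearMap.ker (LinearMap.toSpanSingleton R E (f ^ k • x0))
      monotone' := by
        intro a b hab r hr
        have hr' : r • f ^ a • x0 = 0 := hr
        change r • f ^ b • x0 = 0
        obtain ⟨c, rfl⟩ := Nat.exists_eq_add_of_le' hab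
        rw [pow_add, mul_smul, smul_comm, hr', smul_zero] }
  obtain ⟨N, hN⟩ := monotone_stabilizes_iff_noetherian.2 (inferInstance : IsNoetherian R R) J
  have hN' : ∀ (r : R) (k : ℕ), r • f ^ k • x0 = 0 → r • f ^ N • x0 = 0 := by
    intro r k hr
    have h1 : r ∈ J k := hr
    have h2 : r ∈ J (max N k) := J.monotone (le_max_right _ _) h1
    rw [← hN _ (le_max_left _ _)] at h2
    exact h2
  let u : R →ₗ[R] R ⧸ L := LinearMap.toSpanSingleton R _ (Ideal.Quotient.mk L (f ^ (t + N)))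
  have hu : ∀ r, u r = Ideal.Quotient.mk L (r * f ^ (t + N)) := fun r => rfl
  let g : R →ₗ[R] E := LinearMap.toSpanSingleton R _ (f ^ N • x0)
  have hk : LinearMap.ker u ≤ LinearMap.ker g := by
    intro r hr
    have h1 : r * f ^ (t + N) ∈ L := by
      rw [← Ideal.Quotient.eq_zero_iff_mem, ← hu]; exact hr
    have h2 := hy _ h1
    have h3 : mkf f E (r • f ^ N • x0) = 0 := by
      rw [map_smul, map_smul, ← h0, ← mul_smul, ← mul_smul, ← h2]
      congr 1
      rw [pow_add]; ring
    obtain ⟨k, hk⟩ := (mkf_eq_zero f E _).1 h3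
    apply hN' r (k + N)
    rw [pow_add, mul_smul, smul_comm]
    exact hk
  obtain ⟨h, hh⟩ := hE.out ((LinearMap.ker u).liftQ u le_rfl)
    (LinearMap.ker_eq_bot.1 (Submodule.ker_liftQ_eq_bot' _ _ rfl)) ((LinearMap.ker u).liftQ g hk)
  have hh' : ∀ r, h (u r) = r • f ^ N • x0 := fun r => hh (Submodule.Quotient.mk r)
  refine ⟨h (Ideal.Quotient.mk L 1), ?_, ?_⟩
  · apply pow_smul_inj f E (t + N)
    have h1 := hh' 1
    rw [hu, one_mul, one_smul] at h1
    have h2 : f ^ (t + N) • (Ideal.Quotient.mk L 1 : R ⧸ L) = Ideal.Quotient.mk L (f ^ (t + N)) := by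
      rw [← mul_one (f ^ (t + N)), map_mul]
      simp [Algebra.smul_def]
    rw [← map_smul, ← map_smul, h2, h1, map_smul, ← h0, ← mul_smul, ← pow_add, add_comm]
  · intro a ha
    rw [← map_smul]
    have h2 : a • (Ideal.Quotient.mk L 1 : R ⧸ L) = 0 := by
      have : a • (Ideal.Quotient.mk L 1 : R ⧸ L) = Ideal.Quotient.mk L a := by
        simp [Algebra.smul_def]
      rw [this]
      exact Ideal.Quotient.eq_zero_iff_mem.2 ha
    rw [h2, map_zero]

lemma cech_vanish (fs : List R) : ∀ (E : ModuleCat.{u} R) (_ : Module.Injective R E) (i : ℕ)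
    (z : cX fs E (i + 1)), cd fs E (i + 1) z = 0 → ∃ w, cd fs E i w = z := by
  induction fs with
  | nil => intro E hE i z _; exact ⟨0, rfl⟩
  | cons f fs ih =>
    intro E hE i z hz
    cases i with
    | zero =>
      obtain ⟨a, b⟩ := z
      have h1 : cd fs E 1 a = 0 := congrArg Prod.fst hz
      have h2 : cmap fs (mkf f E) 1 a - cd fs (Mf f E) 0 b = 0 := congrArg Prod.snd hz
      obtain ⟨w, rfl⟩ := ih E hE 0 a h1
      rw [cmap_cd, ← map_sub] at h2
      obtain ⟨y, hy⟩ := (aug fs (Mf f E)).surjective (cmap fs (mkf f E) 0 w - b)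
      rw [← hy, cd_aug_Gam] at h2
      obtain ⟨s, hs⟩ := h2
      obtain ⟨x, hx, hxs⟩ := inj_lift f E hE _ y hs
      have h3 : cd fs E 0 (aug fs E x) = 0 := (cd_aug_Gam fs E x).2 ⟨s, hxs⟩
      have h4 : cd fs E 0 (w - aug fs E x) = cd fs E 0 w := by rw [map_sub, h3, sub_zero]
      have h5 : cmap fs (mkf f E) 0 (w - aug fs E x) = b := by
        rw [map_sub, cmap_aug, hx, hy, sub_sub_cancel]
      exact ⟨w - aug fs E x, Prod.ext h4 h5⟩
    | succ i =>
      obtain ⟨a, b⟩ := z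
      have h1 : cd fs E (i + 2) a = 0 := congrArg Prod.fst hz
      have h2 : cmap fs (mkf f E) (i + 2) a - cd fs (Mf f E) (i + 1) b = 0 := congrArg Prod.snd hz
      obtain ⟨w, rfl⟩ := ih E hE (i + 1) a h1
      rw [cmap_cd, ← map_sub] at h2
      obtain ⟨v, hv⟩ := ih _ (inj_Mf f E hE) i _ h2
      have h5 : cmap fs (mkf f E) (i + 1) w - cd fs (Mf f E) i v = b := by
        rw [hv, sub_sub_cancel]
      exact ⟨(w, v), Prod.ext rfl h5⟩

end cechN
end LCFin

end part12

section part13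

set_option linter.unusedSimpArgs false
set_option linter.unusedSectionVars false

namespace LCFin
section snake
variable {R : Type u} [CommRing R] [IsNoetherianRing R]

/-- Cech coboundaries -/
noncomputable def cB (fs : List R) (M : ModuleCat.{u} R) : ∀ i : ℕ, Submodule R (cX fs M i)
  | 0 => ⊥
  | i + 1 => LinearMap.range (cd fs M i)

/-- comparison relation -/
def Cmp (fs : List R) (M : ModuleCat.{u} R) (i : ℕ) {E N : ModuleCat.{u} R} (p : E ⟶ N) : Prop :=
  ∃ S : N → cX fs M i → Prop,
    (∀ (r : R) y m, S y m → S (r • y) (r • m)) ∧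
    (∀ y ∈ Gam (Ideal.span {f | f ∈ fs}) N, ∃ m, cd fs M i m = 0 ∧ S y m) ∧
    (∀ y m, y ∈ Gam (Ideal.span {f | f ∈ fs}) N → S y m →
      ((∃ e ∈ Gam (Ideal.span {f | f ∈ fs}) E, p.hom e = y) ↔ m ∈ cB fs M i))

lemma cmp_zero (fs : List R) (M E : ModuleCat.{u} R) : Cmp fs M 0 (0 : E ⟶ M) := by
  refine ⟨fun y m => m = aug fs M y, ?_, ?_, ?_⟩
  · rintro r y m rfl
    rw [map_smul]
  · intro y hy
    exact ⟨_, (cd_aug_Gam fs M y).2 hy, rfl⟩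
  · rintro y m hy rfl
    change _ ↔ aug fs M y = 0
    rw [LinearEquiv.map_eq_zero_iff]
    constructor
    · rintro ⟨e, _, rfl⟩
      rfl
    · rintro rfl
      exact ⟨0, Submodule.zero_mem _, rfl⟩

lemma cmp_one (fs : List R) {M E Q : ModuleCat.{u} R} (a : M ⟶ E) (b : E ⟶ Q)
    (ha : Function.Injective a.hom) (hb : Function.Surjective b.hom)
    (hab : Function.Exact a.hom b.hom) : Cmp fs M 1 b := by
  have ex := fun i => cmap_exact fs a.hom b.hom hab i
  have inj := fun i => cmap_inj fs a.hom ha i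
  refine ⟨fun y m => ∃ e, cmap fs b.hom 0 e = aug fs Q y ∧ cd fs E 0 e = cmap fs a.hom 1 m,
    ?_, ?_, ?_⟩
  · rintro r y m ⟨e, h1, h2⟩
    exact ⟨r • e, by rw [map_smul, map_smul, h1], by rw [map_smul, map_smul, h2]⟩
  · intro y hy
    obtain ⟨e, he⟩ := cmap_surj fs b.hom hb 0 (aug fs Q y)
    have h1 : cmap fs b.hom 1 (cd fs E 0 e) = 0 := by
      rw [cmap_cd fs b.hom 0 e, he, (cd_aug_Gam fs Q y).2 hy]
    obtain ⟨m, hm⟩ := (ex 1 _).1 h1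
    refine ⟨m, ?_, e, he, hm.symm⟩
    apply inj 2
    rw [cmap_cd fs a.hom 1 m, hm, cd_cd, map_zero]
  · rintro y m hy ⟨e, h1, h2⟩
    constructor
    · rintro ⟨e0, he0, rfl⟩
      have h3 : cmap fs b.hom 0 (e - aug fs E e0) = 0 := by
        rw [map_sub, h1, cmap_aug, sub_self]
      obtain ⟨m', hm'⟩ := (ex 0 _).1 h3
      refine ⟨m', inj 1 ?_⟩
      rw [cmap_cd fs a.hom 0 m', hm', map_sub, (cd_aug_Gam fs E e0).2 he0, sub_zero, h2]
    · rintro ⟨m', rfl⟩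
      obtain ⟨e0, he0⟩ := (aug fs E).surjective (e - cmap fs a.hom 0 m')
      refine ⟨e0, (cd_aug_Gam fs E e0).1 ?_, (aug fs Q).injective ?_⟩
      · rw [he0, map_sub, h2, cmap_cd fs a.hom 0 m', sub_self]
      · rw [← cmap_aug, he0, map_sub, h1, (ex 0 _).2 ⟨m', rfl⟩, sub_zero]

lemma cmp_succ (fs : List R) {M E Q : ModuleCat.{u} R} (a : M ⟶ E) (b : E ⟶ Q)
    (ha : Function.Injective a.hom) (hb : Function.Surjective b.hom)
    (hab : Function.Exact a.hom b.hom) (hE : Module.Injective R E) (i : ℕ)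
    {E' N' : ModuleCat.{u} R} (p : E' ⟶ N') (h : Cmp fs Q (i + 1) p) : Cmp fs M (i + 2) p := by
  have ex := fun i => cmap_exact fs a.hom b.hom hab i
  have inj := fun i => cmap_inj fs a.hom ha i
  obtain ⟨S, hS0, hS1, hS2⟩ := h
  refine ⟨fun y m => ∃ e, S y (cmap fs b.hom (i + 1) e) ∧
    cd fs E (i + 1) e = cmap fs a.hom (i + 2) m, ?_, ?_, ?_⟩
  · rintro r y m ⟨e, h1, h2⟩
    exact ⟨r • e, by rw [map_smul]; exact hS0 r _ _ h1, by rw [map_smul, map_smul, h2]⟩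
  · intro y hy
    obtain ⟨z, hz, hyz⟩ := hS1 y hy
    obtain ⟨e, rfl⟩ := cmap_surj fs b.hom hb (i + 1) z
    rw [← cmap_cd fs b.hom (i + 1) e] at hz
    obtain ⟨m, hm⟩ := (ex (i + 2) _).1 hz
    refine ⟨m, ?_, e, hyz, hm.symm⟩
    apply inj (i + 3)
    rw [cmap_cd fs a.hom (i + 2) m, hm, cd_cd, map_zero]
  · rintro y m hy ⟨e, h1, h2⟩
    rw [hS2 y _ hy h1]
    constructor
    · rintro ⟨q, hq⟩
      obtain ⟨e', rfl⟩ := cmap_surj fs b.hom hb i q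
      have h3 : cmap fs b.hom (i + 1) (e - cd fs E i e') = 0 := by
        rw [map_sub, cmap_cd fs b.hom i e', hq, sub_self]
      obtain ⟨m', hm'⟩ := (ex (i + 1) _).1 h3
      refine ⟨m', inj (i + 2) ?_⟩
      rw [cmap_cd fs a.hom (i + 1) m', hm', map_sub, cd_cd, sub_zero, h2]
    · rintro ⟨m', rfl⟩
      have h3 : cd fs E (i + 1) (e - cmap fs a.hom (i + 1) m') = 0 := by
        rw [map_sub, h2, cmap_cd fs a.hom (i + 1) m', sub_self]
      obtain ⟨e', he'⟩ := cech_vanish fs E hE i _ h3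
      refine ⟨cmap fs b.hom i e', ?_⟩
      rw [← cmap_cd fs b.hom i e', he', map_sub, (ex (i + 1) _).2 ⟨m', rfl⟩, sub_zero]

/-- chosen short exact sequence -/
lemma exists_ses (M : ModuleCat.{u} R) : ∃ S : ShortComplex (ModuleCat.{u} R),
    S.ShortExact ∧ S.X₁ = M ∧ Injective S.X₂ := by
  refine ⟨ShortComplex.mk (Injective.ι M) (Limits.cokernel.π (Injective.ι M)) (by simp), ?_, rfl,
    inferInstance⟩
  exact { exact := ShortComplex.exact_of_g_is_cokernel _ (Limits.cokernelIsCokernel _) }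

theorem exists_cmp (fs : List R) (i : ℕ) : ∀ M : ModuleCat.{u} R,
    ∃ (E N : ModuleCat.{u} R) (p : E ⟶ N), IsW M i p ∧ Cmp fs M i p := by
  have step : ∀ i, (∀ M : ModuleCat.{u} R,
      ∃ (E N : ModuleCat.{u} R) (p : E ⟶ N), IsW M (i + 1) p ∧ Cmp fs M (i + 1) p) := by
    intro i
    induction i with
    | zero =>
      intro M
      obtain ⟨S, hS, rfl, hI⟩ := exists_ses M
      exact ⟨_, _, S.g, isW_one hS, cmp_one fs S.f S.g hS.moduleCat_injective_f
        hS.moduleCat_surjective_g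
        ((ShortComplex.ShortExact.moduleCat_exact_iff_function_exact S).1 hS.exact)⟩
    | succ i ih =>
      intro M
      obtain ⟨S, hS, rfl, hI⟩ := exists_ses M
      obtain ⟨E, N, p, h1, h2⟩ := ih S.X₃
      exact ⟨E, N, p, isW_succ hS p h1, cmp_succ fs S.f S.g hS.moduleCat_injective_f
        hS.moduleCat_surjective_g
        ((ShortComplex.ShortExact.moduleCat_exact_iff_function_exact S).1 hS.exact)
        ((Module.injective_iff_injective_object R S.X₂).2 hI) i p h2⟩
  cases i with
  | zero => exact fun M => ⟨M, M, 0, isW_zero M M, cmp_zero fs M M⟩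
  | succ i => exact step i

/-- associated primes of local cohomology via Cech cohomology -/
theorem ass_lc (fs : List R) (M : ModuleCat.{u} R) (i : ℕ) (P : Ideal R)
    (hP : P ∈ associatedPrimes R ((localCohomology (Ideal.span {f | f ∈ fs}) i).obj M)) :
    P.IsPrime ∧ ∃ m, cd fs M i m = 0 ∧ ∀ r, r ∈ P ↔ r • m ∈ cB fs M i := by
  obtain ⟨E, N, p, hW, S, hS0, hS1, hS2⟩ := exists_cmp fs i M
  obtain ⟨Φ, hΦ, hΦ0⟩ := lc_desc (Ideal.span {f | f ∈ fs}) M i hW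
  obtain ⟨hp, w, hw⟩ := (isAssociatedPrime_iff).1 hP
  refine ⟨hp, ?_⟩
  obtain ⟨y, rfl⟩ := hΦ w
  obtain ⟨m, hm, hym⟩ := hS1 y.1 y.2
  refine ⟨m, hm, fun r => ?_⟩
  rw [hw, Submodule.mem_colon_singleton, Submodule.mem_bot, ← map_smul, hΦ0,
    ← hS2 _ _ (r • y).2 (hS0 r _ _ hym)]

end snake
end LCFin

end part13

section part14

set_option linter.unusedSimpArgs false
set_option linter.unusedSectionVars false

namespace LCFin
section assembly
variable {A : Type u} [CommRing A] {n : ℕ}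

noncomputable instance mfDStr (f : MvPolynomial (Fin n) A) (M : ModuleCat.{u} (MvPolynomial (Fin n) A))
    [DStr n A M] : DStr n A (Mf f M) :=
  inferInstanceAs (DStr n A (LocalizedModule (Submonoid.powers f) M))

/-- Hasse derivatives on Cech cochains -/
@[reducible]
noncomputable def cDS : ∀ (fs : List (MvPolynomial (Fin n) A))
    (M : ModuleCat.{u} (MvPolynomial (Fin n) A)) (_ : DStr n A M) (i : ℕ), DStr n A (cX fs M i)
  | [], _, h, 0 => h
  | [], _, _, _ + 1 => inferInstanceAs (DStr n A PUnit.{u+1})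
  | _ :: fs, M, h, 0 => cDS fs M h 0
  | f :: fs, M, h, i + 1 =>
    letI := cDS fs M h (i + 1)
    letI := cDS fs (Mf f M) (mfDStr f M) i
    inferInstanceAs (DStr n A (cX fs M (i + 1) × cX fs (Mf f M) i))

noncomputable instance (fs : List (MvPolynomial (Fin n) A))
    (M : ModuleCat.{u} (MvPolynomial (Fin n) A)) [h : DStr n A M] (i : ℕ) : DStr n A (cX fs M i) :=
  cDS fs M h i

lemma dd_cX_zero (f : MvPolynomial (Fin n) A) (fs : List (MvPolynomial (Fin n) A))
    (M : ModuleCat.{u} (MvPolynomial (Fin n) A)) [DStr n A M] (b) (a : cX fs M 0) :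
    dd n A b (M := cX (f :: fs) M 0) a = dd n A b (M := cX fs M 0) a := rfl

lemma dd_cX_succ (f : MvPolynomial (Fin n) A) (fs : List (MvPolynomial (Fin n) A))
    (M : ModuleCat.{u} (MvPolynomial (Fin n) A)) [DStr n A M] (i : ℕ) (b) (a : cX fs M (i + 1))
    (c : cX fs (Mf f M) i) :
    dd n A b (M := cX (f :: fs) M (i + 1)) (a, c) = (dd n A b a, dd n A b c) := rfl

lemma dd_sub {M : Type*} [AddCommGroup M] [Module (MvPolynomial (Fin n) A) M] [DStr n A M]
    (b : Fin n →₀ ℕ) (m m' : M) : dd n A b (m - m') = dd n A b m - dd n A b m' := by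
  rw [eq_sub_iff_add_eq, ← dd_add, sub_add_cancel]

lemma dd_mkf (f : MvPolynomial (Fin n) A) (M : ModuleCat.{u} (MvPolynomial (Fin n) A))
    [DStr n A M] (b) (m : M) : mkf f M (dd n A b m) = dd n A b (mkf f M m) :=
  (dd_mk f b m).symm

lemma dd_mapf (f : MvPolynomial (Fin n) A) {M N : ModuleCat.{u} (MvPolynomial (Fin n) A)}
    [DStr n A M] [DStr n A N] (g : M →ₗ[MvPolynomial (Fin n) A] N)
    (hg : ∀ b m, g (dd n A b m) = dd n A b (g m)) (b) (m : Mf f M) :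
    mapf f g (dd n A b m) = dd n A b (mapf f g m) :=
  dd_map_loc f g hg b m

lemma dd_cmap (fs : List (MvPolynomial (Fin n) A)) :
    ∀ {M N : ModuleCat.{u} (MvPolynomial (Fin n) A)}
    [DStr n A M] [DStr n A N] (g : M →ₗ[MvPolynomial (Fin n) A] N)
    (_ : ∀ b m, g (dd n A b m) = dd n A b (g m)) (i : ℕ) (b) (m : cX fs M i),
    cmap fs g i (dd n A b m) = dd n A b (cmap fs g i m) := by
  induction fs with
  | nil =>
    intro M N _ _ g hg i b m
    cases i with
    | zero => exact hg b m
    | succ i => rfl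
  | cons f fs ih =>
    intro M N _ _ g hg i b m
    cases i with
    | zero => exact ih g hg 0 b m
    | succ i =>
      obtain ⟨a, c⟩ := m
      exact Prod.ext (ih g hg (i + 1) b a) (ih (mapf f g) (dd_mapf f g hg) i b c)

lemma dd_cd (fs : List (MvPolynomial (Fin n) A)) :
    ∀ (M : ModuleCat.{u} (MvPolynomial (Fin n) A)) [DStr n A M] (i : ℕ) (b) (m : cX fs M i),
    cd fs M i (dd n A b m) = dd n A b (cd fs M i m) := by
  induction fs with
  | nil =>
    intro M _ i b m
    rfl
  | cons f fs ih =>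
    intro M _ i b m
    cases i with
    | zero => exact Prod.ext (ih M 0 b m) (dd_cmap fs (mkf f M) (dd_mkf f M) 0 b m)
    | succ i =>
      obtain ⟨a, c⟩ := m
      refine Prod.ext (ih M (i + 1) b a) ?_
      change cmap fs (mkf f M) (i + 1) (dd n A b a) - cd fs (Mf f M) i (dd n A b c) =
        dd n A b (cmap fs (mkf f M) (i + 1) a - cd fs (Mf f M) i c)
      rw [dd_sub, ih, dd_cmap fs (mkf f M) (dd_mkf f M) (i + 1) b a]

lemma growth_cX (fs : List (MvPolynomial (Fin n) A)) :
    ∀ (M : ModuleCat.{u} (MvPolynomial (Fin n) A)) [DStr n A M] (_ : GrowthR n A M) (i : ℕ),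
    GrowthR n A (cX fs M i) := by
  induction fs with
  | nil =>
    intro M _ hM i
    cases i with
    | zero =>
      change GrowthR n A M
      exact hM
    | succ i => exact GrowthR.ofSubsingleton (M := PUnit.{u+1})
  | cons f fs ih =>
    intro M _ hM i
    cases i with
    | zero =>
      change GrowthR n A (cX fs M 0)
      exact ih M hM 0
    | succ i =>
      change GrowthR n A (cX fs M (i + 1) × cX fs (Mf f M) i)
      exact GrowthR.prod (ih M hM (i + 1))
        (ih (Mf f M) (GrowthR.loc f (mkf f M) (dd_mkf f M) hM) i)

theorem ass_finite_list [IsArtinianRing A] (fs : List (MvPolynomial (Fin n) A)) (i : ℕ) :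
    (associatedPrimes (MvPolynomial (Fin n) A)
      ((localCohomology (Ideal.span {f | f ∈ fs}) i).obj
        (ModuleCat.of _ (MvPolynomial (Fin n) A)))).Finite := by
  let M : ModuleCat.{u} (MvPolynomial (Fin n) A) := ModuleCat.of _ (MvPolynomial (Fin n) A)
  let _ : DStr n A M := inferInstanceAs (DStr n A (MvPolynomial (Fin n) A))
  have hM : GrowthR n A M := GrowthR.base
  refine (assRel_finite (growth_cX fs M hM i) (cB fs M i) (LinearMap.ker (cd fs M i)) ?_ ?_ ?_).subset
    ?_
  · cases i with
    | zero =>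
      intro b m hm
      have hm' : m = 0 := hm
      change dd n A b m = 0
      rw [hm', dd_map_zero]
    | succ i =>
      rintro b _ ⟨m, rfl⟩
      exact ⟨dd n A b m, dd_cd fs M i b m⟩
  · intro b m hm
    have hm' : cd fs M i m = 0 := hm
    change cd fs M i (dd n A b m) = 0
    rw [dd_cd, hm', dd_map_zero]
  · cases i with
    | zero => exact bot_le
    | succ i =>
      rintro _ ⟨m, rfl⟩
      exact cd_cd fs M i m
  · intro P hP
    obtain ⟨h1, m, h2, h3⟩ := ass_lc fs M i P hP
    exact ⟨h1, m, h2, h3⟩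

end assembly
end LCFin

end part14

theorem associatedPrimes_localCohomology_finite_of_dim_zero_polynomial
    (A : Type u) [CommRing A] [IsNoetherianRing A] (hA : ringKrullDim A = 0)
    (n : ℕ) (I : Ideal (MvPolynomial (Fin n) A)) (i : ℕ) :
    (associatedPrimes (MvPolynomial (Fin n) A)
      ((localCohomology I i).obj (ModuleCat.of _ (MvPolynomial (Fin n) A)))).Finite := by
  have : Ring.KrullDimLE 0 A := by
    rw [Ring.krullDimLE_iff]
    exact hA.le
  have : IsArtinianRing A := IsNoetherianRing.isArtinianRing_of_krullDimLE_zero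
  obtain ⟨s, rfl⟩ := (inferInstance : IsNoetherianRing (MvPolynomial (Fin n) A)).noetherian I
  have h := LCFin.ass_finite_list (A := A) (n := n) s.toList i
  have hs : {f | f ∈ s.toList} = (s : Set (MvPolynomial (Fin n) A)) := by
    ext f
    simp
  rw [hs] at h
  exact h
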